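/- Let K be an algebraically closed field of characteristic 0, G a reductive group over K, and H ≤ G a closed subgroup containing a maximal torus of G. Then Ext¹_H(K, K) = 0, i.e., every extension of the trivial one-dimensional representation of H by itself splits. -/

import Mathlib

open Matrix MvPolynomial

variable {K : Type} [Field K]

/-- The entries and inverse-entries of an element of `GL (Fin n) K`, as a valuation of
variables; used to express Zariski-closedness and polynomiality on `GL n`. -/
def matOf {n : ℕ} (A : GL (Fin n) K) : (Fin n × Fin n) ⊕ (Fin n × Fin n) → K :=
  Sum.elim (fun q => (A : Matrix (Fin n) (Fin n) K) q.1 q.2)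
           (fun q => ((A⁻¹ : GL (Fin n) K) : Matrix (Fin n) (Fin n) K) q.1 q.2)

/-- A subset of `GL n K` is Zariski closed if it is the common zero locus of a family of
polynomials in the matrix entries and the entries of the inverse matrix. -/
def IsZClosed {n : ℕ} (s : Set (GL (Fin n) K)) : Prop :=
  ∃ I : Set (MvPolynomial ((Fin n × Fin n) ⊕ (Fin n × Fin n)) K),
    s = {A | ∀ p ∈ I, eval (matOf A) p = 0}

/-- A subgroup of `GL n K` is connected (for the Zariski topology). -/
def IsConnectedSG {n : ℕ} (H : Subgroup (GL (Fin n) K)) : Prop :=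
  ∀ s t : Set (GL (Fin n) K), IsZClosed s → IsZClosed t →
    (H : Set (GL (Fin n) K)) ⊆ s ∪ t → (H : Set (GL (Fin n) K)) ∩ s ∩ t = ∅ →
    (H : Set (GL (Fin n) K)) ⊆ s ∨ (H : Set (GL (Fin n) K)) ⊆ t

/-- A function on a subgroup of `GL n K` is a polynomial (regular) function if it is given by
a polynomial in the matrix entries and inverse-matrix entries. -/
def IsPolyFun {n : ℕ} (H : Subgroup (GL (Fin n) K)) (f : H → K) : Prop :=
  ∃ p : MvPolynomial ((Fin n × Fin n) ⊕ (Fin n × Fin n)) K,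
    ∀ A : H, f A = eval (matOf (A : GL (Fin n) K)) p

/-- A homomorphism of linear algebraic groups: a group homomorphism which is regular. -/
structure AlgGroupHom {n m : ℕ} (H : Subgroup (GL (Fin n) K)) (H' : Subgroup (GL (Fin m) K)) where
  toFun : H →* H'
  poly : ∀ i j : Fin m,
    IsPolyFun H (fun A => ((toFun A : GL (Fin m) K) : Matrix (Fin m) (Fin m) K) i j)

/-- A homomorphism of algebraic groups from `H` to the additive group `G_a`. -/
structure GaHom {n : ℕ} (H : Subgroup (GL (Fin n) K)) where
  toFun : H → K
  map_mul : ∀ A B : H, toFun (A * B) = toFun A + toFun B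
  poly : IsPolyFun H toFun

/-- Base change `GL n K → GL n K̄`. -/
noncomputable def glBaseChange {n : ℕ} : GL (Fin n) K →* GL (Fin n) (AlgebraicClosure K) :=
  Units.map ((algebraMap K (AlgebraicClosure K)).mapMatrix.toMonoidHom)

/-- A torus: a Zariski-closed connected subgroup which is diagonalizable over the algebraic
closure. -/
def IsTorus {n : ℕ} (T : Subgroup (GL (Fin n) K)) : Prop :=
  IsZClosed (T : Set (GL (Fin n) K)) ∧ IsConnectedSG T ∧
  ∃ g : GL (Fin n) (AlgebraicClosure K), ∀ A ∈ T,
    Matrix.IsDiag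
      ((g * glBaseChange A * g⁻¹ : GL (Fin n) (AlgebraicClosure K)) :
        Matrix (Fin n) (Fin n) (AlgebraicClosure K))

/-- `T` is a maximal torus of `G`. -/
def IsMaximalTorus {n : ℕ} (G T : Subgroup (GL (Fin n) K)) : Prop :=
  IsTorus T ∧ T ≤ G ∧
    ∀ T' : Subgroup (GL (Fin n) K), IsTorus T' → T' ≤ G → T ≤ T' → T' = T

/-- A unipotent element of `GL n K`. -/
def IsUnipotentElt {n : ℕ} (A : GL (Fin n) K) : Prop :=
  ((A : Matrix (Fin n) (Fin n) K) - 1) ^ n = 0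

/-- A (connected) reductive group: closed, connected, with trivial unipotent radical, i.e.
every Zariski-closed connected normal subgroup consisting of unipotent elements is trivial. -/
def IsReductive {n : ℕ} (G : Subgroup (GL (Fin n) K)) : Prop :=
  IsZClosed (G : Set (GL (Fin n) K)) ∧ IsConnectedSG G ∧
  ∀ U : Subgroup (GL (Fin n) K), U ≤ G → IsZClosed (U : Set (GL (Fin n) K)) →
    IsConnectedSG U → (∀ g ∈ G, ∀ u ∈ U, g * u * g⁻¹ ∈ U) →
    (∀ u ∈ U, IsUnipotentElt u) → U = ⊥

/-- A torus has rank `r` if it is isomorphic, as an algebraic group, to `G_m^r`. -/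
def TorusHasRank {n : ℕ} (T : Subgroup (GL (Fin n) K)) (r : ℕ) : Prop :=
  ∃ e : T ≃* (Fin r → Kˣ),
    (∀ i : Fin r, IsPolyFun T (fun A => ((e A i : Kˣ) : K))) ∧
    (∀ i j : Fin n, ∃ p : MvPolynomial (Fin r ⊕ Fin r) K, ∀ v : Fin r → Kˣ,
      (((e.symm v : T) : GL (Fin n) K) : Matrix (Fin n) (Fin n) K) i j =
        eval (Sum.elim (fun k => ((v k : Kˣ) : K)) (fun k => (((v k)⁻¹ : Kˣ) : K))) p)

/-- The reductive rank of `G` is `r`: some maximal torus of `G` has rank `r`. -/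
def HasRedRank {n : ℕ} (G : Subgroup (GL (Fin n) K)) (r : ℕ) : Prop :=
  ∃ T : Subgroup (GL (Fin n) K), IsMaximalTorus G T ∧ TorusHasRank T r

namespace GLZariski

attribute [local instance] LieRing.ofAssociativeRing

variable {n : ℕ}

/-- Evaluation of a polynomial in the matrix entries at a matrix over a `K`-algebra. -/
noncomputable def ev {R : Type*} [CommRing R] [Algebra K R] (A : Matrix (Fin n) (Fin n) R) :
    MvPolynomial (Fin n × Fin n) K →ₐ[K] R :=
  aeval fun q => A q.1 q.2

/-- The ideal of polynomials in the matrix entries vanishing on a set of invertible matrices. -/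
def vanish (s : Set (GL (Fin n) K)) : Ideal (MvPolynomial (Fin n × Fin n) K) where
  carrier := {p | ∀ A ∈ s, ev (A : Matrix (Fin n) (Fin n) K) p = 0}
  add_mem' hp hq A hA := by rw [map_add, hp A hA, hq A hA, add_zero]
  zero_mem' A _ := map_zero _
  smul_mem' c p hp A hA := by rw [smul_eq_mul, map_mul, hp A hA, mul_zero]

@[simp] lemma ev_X {R : Type*} [CommRing R] [Algebra K R] (A : Matrix (Fin n) (Fin n) R)
    (q : Fin n × Fin n) : ev (K := K) A (X q) = A q.1 q.2 := by simp [ev]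

@[simp] lemma ev_C {R : Type*} [CommRing R] [Algebra K R] (A : Matrix (Fin n) (Fin n) R)
    (c : K) : ev A (C c) = algebraMap K R c := by simp [ev]

lemma map_ev {R S : Type*} [CommRing R] [Algebra K R] [CommRing S] [Algebra K S] (φ : R →ₐ[K] S)
    (A : Matrix (Fin n) (Fin n) R) (p : MvPolynomial (Fin n × Fin n) K) :
    φ (ev A p) = ev (A.map φ) p := by
  have : φ.comp (ev A) = ev (A.map φ) := by ext q; simp
  exact DFunLike.congr_fun this p

/-- Left translation of polynomials by a matrix. -/
noncomputable def ltrans (B : Matrix (Fin n) (Fin n) K) :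
    MvPolynomial (Fin n × Fin n) K →ₐ[K] MvPolynomial (Fin n × Fin n) K :=
  aeval fun q => ∑ k, C (B q.1 k) * X (k, q.2)

/-- Right translation of polynomials by a matrix. -/
noncomputable def rtrans (B : Matrix (Fin n) (Fin n) K) :
    MvPolynomial (Fin n × Fin n) K →ₐ[K] MvPolynomial (Fin n × Fin n) K :=
  aeval fun q => ∑ k, X (q.1, k) * C (B k q.2)

lemma ev_ltrans {R : Type*} [CommRing R] [Algebra K R] (B : Matrix (Fin n) (Fin n) K)
    (A : Matrix (Fin n) (Fin n) R) (p : MvPolynomial (Fin n × Fin n) K) :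
    ev A (ltrans B p) = ev (B.map (algebraMap K R) * A) p := by
  have : (ev A).comp (ltrans B) = ev (B.map (algebraMap K R) * A) := by
    ext q; simp [ltrans, Matrix.mul_apply]
  exact DFunLike.congr_fun this p

lemma ev_rtrans {R : Type*} [CommRing R] [Algebra K R] (B : Matrix (Fin n) (Fin n) K)
    (A : Matrix (Fin n) (Fin n) R) (p : MvPolynomial (Fin n × Fin n) K) :
    ev A (rtrans B p) = ev (A * B.map (algebraMap K R)) p := by
  have : (ev A).comp (rtrans B) = ev (A * B.map (algebraMap K R)) := by
    ext q; simp [rtrans, Matrix.mul_apply]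
  exact DFunLike.congr_fun this p

/-- The derivation of the polynomial ring given by right multiplication with a matrix. -/
noncomputable def rder (Y : Matrix (Fin n) (Fin n) K) :
    Derivation K (MvPolynomial (Fin n × Fin n) K) (MvPolynomial (Fin n × Fin n) K) :=
  mkDerivation K fun q => ∑ k, X (q.1, k) * C (Y k q.2)

@[simp] lemma rder_X (Y : Matrix (Fin n) (Fin n) K) (q : Fin n × Fin n) :
    rder Y (X q) = ∑ k, X (q.1, k) * C (Y k q.2) := by simp [rder]

lemma rder_add (Y Z : Matrix (Fin n) (Fin n) K) : rder (Y + Z) = rder Y + rder Z := by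
  ext q : 1
  simp [mul_add, Finset.sum_add_distrib]

lemma rder_smul (c : K) (Y : Matrix (Fin n) (Fin n) K) : rder (c • Y) = c • rder Y := by
  ext q : 1
  simp only [rder_X, Derivation.coe_smul, Pi.smul_apply, Matrix.smul_apply, smul_eq_mul, C_mul,
    Finset.smul_sum, MvPolynomial.smul_eq_C_mul]
  exact Finset.sum_congr rfl fun _ _ => by ring

lemma rder_zero : rder (0 : Matrix (Fin n) (Fin n) K) = 0 := by
  ext q : 1
  simp

lemma rder_lie (Y Z : Matrix (Fin n) (Fin n) K) : rder ⁅Y, Z⁆ = ⁅rder Y, rder Z⁆ := by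
  have key : ∀ (Y Z : Matrix (Fin n) (Fin n) K) (q : Fin n × Fin n),
      rder Y (rder Z (X q)) = ∑ k, X (q.1, k) * C ((Y * Z) k q.2) := by
    intro Y Z q
    simp only [rder_X, map_sum, Derivation.leibniz, derivation_C, smul_eq_mul, mul_zero, zero_add,
      Matrix.mul_apply, C_mul, Finset.mul_sum]
    rw [Finset.sum_comm]
    exact Finset.sum_congr rfl fun _ _ => Finset.sum_congr rfl fun _ _ => by ring
  ext q : 1
  rw [Derivation.commutator_apply, key, key, rder_X]
  simp [Ring.lie_def, mul_sub, Finset.sum_sub_distrib]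

/-- The matrices whose right-multiplication derivation preserves an ideal. -/
def lieOf (I : Ideal (MvPolynomial (Fin n × Fin n) K)) :
    LieSubalgebra K (Matrix (Fin n) (Fin n) K) where
  carrier := {Y | ∀ p ∈ I, rder Y p ∈ I}
  add_mem' hY hZ p hp := by
    rw [rder_add]; exact I.add_mem (hY p hp) (hZ p hp)
  zero_mem' p _ := by rw [rder_zero]; exact I.zero_mem
  smul_mem' c Y hY p hp := by
    rw [rder_smul, Derivation.coe_smul, Pi.smul_apply, MvPolynomial.smul_eq_C_mul]
    exact I.mul_mem_left _ (hY p hp)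
  lie_mem' {Y Z} hY hZ p hp := by
    rw [rder_lie, Derivation.commutator_apply]
    exact I.sub_mem (hY _ (hZ p hp)) (hZ _ (hY p hp))

/-- Chain rule. -/
lemma map_derivation_ev {R S : Type*} [CommRing R] [Algebra K R] [CommRing S] [Algebra K S]
    (δ : Derivation K R R) (ε : R →ₐ[K] S) (F : Matrix (Fin n) (Fin n) R)
    (Y : Matrix (Fin n) (Fin n) K)
    (hF : F.map (fun x => ε (δ x)) = F.map ε * Y.map (algebraMap K S))
    (p : MvPolynomial (Fin n × Fin n) K) :
    ε (δ (ev F p)) = ev (F.map ε) (rder Y p) := by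
  induction p using MvPolynomial.induction_on with
  | C a => simp
  | add p q hp hq => simp only [map_add, hp, hq]
  | mul_X p q hp =>
    have h := congrFun (congrFun hF q.1) q.2
    simp only [Matrix.map_apply, Matrix.mul_apply] at h
    simp only [map_mul, Derivation.leibniz, smul_eq_mul, map_add, hp, ev_X, rder_X, map_sum, ev_C,
      Matrix.map_apply, h, map_ev]

/-- A matrix tangent at the identity to a formal curve in a group lies in its Lie algebra. -/
lemma mem_lieOf_of_tangent {R : Type*} [CommRing R] [Algebra K R]
    (δ : Derivation K R R) (ε : R →ₐ[K] K) (F : Matrix (Fin n) (Fin n) R)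
    (H : Subgroup (GL (Fin n) K)) (hF : ∀ p ∈ vanish (H : Set (GL (Fin n) K)), ev F p = 0)
    (h1 : F.map ε = 1) :
    F.map (fun x => ε (δ x)) ∈ lieOf (vanish (H : Set (GL (Fin n) K))) := by
  intro p hp A hA
  have hq : ltrans (A : Matrix (Fin n) (Fin n) K) p ∈ vanish (H : Set (GL (Fin n) K)) := by
    intro B hB
    rw [ev_ltrans]
    exact hp (A * B) (H.mul_mem hA hB)
  have h0 := hF _ hq
  rw [ev_ltrans] at h0
  have hA' : (((A : Matrix (Fin n) (Fin n) K).map (algebraMap K R)).map ε) =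
      (A : Matrix (Fin n) (Fin n) K) := by ext; simp
  have h2 := map_derivation_ev δ ε ((A : Matrix (Fin n) (Fin n) K).map (algebraMap K R) * F)
    (F.map (fun x => ε (δ x))) (by
      rw [Matrix.map_mul, hA', h1, mul_one]
      ext i j
      simp [Matrix.mul_apply]) p
  rw [h0, map_zero, map_zero, Matrix.map_mul, hA', h1, mul_one] at h2
  exact h2.symm

/-- Conjugation by elements of the group preserves the Lie algebra. -/
lemma conj_mem_lieOf (H : Subgroup (GL (Fin n) K)) {A : GL (Fin n) K} (hA : A ∈ H)
    {Y : Matrix (Fin n) (Fin n) K} (hY : Y ∈ lieOf (vanish (H : Set (GL (Fin n) K)))) :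
    (A : Matrix (Fin n) (Fin n) K) * Y * ((A⁻¹ : GL (Fin n) K) : Matrix (Fin n) (Fin n) K) ∈
      lieOf (vanish (H : Set (GL (Fin n) K))) := by
  intro p hp B hB
  have hq : rtrans ((A⁻¹ : GL (Fin n) K) : Matrix (Fin n) (Fin n) K) p ∈
      vanish (H : Set (GL (Fin n) K)) := by
    intro B hB
    rw [ev_rtrans]
    exact hp (B * A⁻¹) (H.mul_mem hB (H.inv_mem hA))
  have h1 := hY _ hq (B * A) (H.mul_mem hB hA)
  set F : Matrix (Fin n) (Fin n) (MvPolynomial (Fin n × Fin n) K) := Matrix.of fun i j =>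
    ∑ k, X (i, k) * C (((A⁻¹ : GL (Fin n) K) : Matrix (Fin n) (Fin n) K) k j) with hF
  have hFε : F.map (ev ((B * A : GL (Fin n) K) : Matrix (Fin n) (Fin n) K)) =
      (B : Matrix (Fin n) (Fin n) K) := by
    have : F.map (ev ((B * A : GL (Fin n) K) : Matrix (Fin n) (Fin n) K)) =
        ((B * A * A⁻¹ : GL (Fin n) K) : Matrix (Fin n) (Fin n) K) := by
      ext i j
      rw [Units.val_mul (B * A)]
      simp [hF, Matrix.mul_apply]
    rw [this, mul_inv_cancel_right]
  have h2 := map_derivation_ev (rder Y) (ev ((B * A : GL (Fin n) K) : Matrix (Fin n) (Fin n) K)) F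
    ((A : Matrix (Fin n) (Fin n) K) * Y * ((A⁻¹ : GL (Fin n) K) : Matrix (Fin n) (Fin n) K))
    (by
      rw [hFε]
      have : (B : Matrix (Fin n) (Fin n) K) * ((A : Matrix (Fin n) (Fin n) K) * Y *
          ((A⁻¹ : GL (Fin n) K) : Matrix (Fin n) (Fin n) K)) =
          ((B * A : GL (Fin n) K) : Matrix (Fin n) (Fin n) K) * Y *
          ((A⁻¹ : GL (Fin n) K) : Matrix (Fin n) (Fin n) K) := by
        simp only [Units.val_mul, mul_assoc]
      ext i j
      simp only [Algebra.algebraMap_self, RingHom.coe_id, Matrix.map_id, this]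
      simp only [hF, Matrix.map_apply, Matrix.of_apply, map_sum, Derivation.leibniz, derivation_C,
        smul_eq_mul, rder_X, Matrix.mul_apply]
      refine Finset.sum_congr rfl fun _ _ => ?_
      simp [Matrix.mul_apply, mul_comm]) p
  rw [hFε] at h2
  rw [← h2]
  exact h1

end GLZariski

namespace GLZariski

variable {n : ℕ}

/-- The determinant as a polynomial in the matrix entries. -/
noncomputable def detPoly (K : Type) [Field K] (n : ℕ) : MvPolynomial (Fin n × Fin n) K :=
  (Matrix.of fun i j => X (i, j)).det

@[simp] lemma ev_detPoly {R : Type*} [CommRing R] [Algebra K R] (A : Matrix (Fin n) (Fin n) R) :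
    ev A (detPoly K n) = A.det := by
  rw [detPoly, AlgHom.map_det]
  congr 1
  ext i j
  simp

lemma exists_clear_denominators (p : MvPolynomial ((Fin n × Fin n) ⊕ (Fin n × Fin n)) K) :
    ∃ (N : ℕ) (q : MvPolynomial (Fin n × Fin n) K), ∀ A : GL (Fin n) K,
      ev (A : Matrix (Fin n) (Fin n) K) q =
        (A : Matrix (Fin n) (Fin n) K).det ^ N * eval (matOf A) p := by
  induction p using MvPolynomial.induction_on with
  | C a => exact ⟨0, C a, fun A => by simp⟩
  | add p p' hp hp' =>
    obtain ⟨N, q, h⟩ := hp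
    obtain ⟨N', q', h'⟩ := hp'
    refine ⟨N + N', detPoly K n ^ N' * q + detPoly K n ^ N * q', fun A => ?_⟩
    simp only [map_add, map_mul, map_pow, ev_detPoly, h, h']
    ring
  | mul_X p s hp =>
    obtain ⟨N, q, h⟩ := hp
    rcases s with s | s
    · refine ⟨N, q * X s, fun A => ?_⟩
      simp [h, matOf, mul_assoc]
    · refine ⟨N + 1, q * (Matrix.of fun i j : Fin n =>
        (X (i, j) : MvPolynomial (Fin n × Fin n) K)).adjugate s.1 s.2, fun A => ?_⟩
      have hadj : ev (A : Matrix (Fin n) (Fin n) K)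
          ((Matrix.of fun i j : Fin n =>
            (X (i, j) : MvPolynomial (Fin n × Fin n) K)).adjugate s.1 s.2) =
          (A : Matrix (Fin n) (Fin n) K).adjugate s.1 s.2 := by
        have h1 := AlgHom.map_adjugate (ev (A : Matrix (Fin n) (Fin n) K))
          (Matrix.of fun i j : Fin n => (X (i, j) : MvPolynomial (Fin n × Fin n) K))
        have h2 := congrFun (congrFun h1 s.1) s.2
        rw [AlgHom.mapMatrix_apply, Matrix.map_apply] at h2
        rw [h2]
        congr 2
        ext i j
        simp
      have hinv : (A : Matrix (Fin n) (Fin n) K).adjugate =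
          (A : Matrix (Fin n) (Fin n) K).det •
            ((A⁻¹ : GL (Fin n) K) : Matrix (Fin n) (Fin n) K) := by
        calc (A : Matrix (Fin n) (Fin n) K).adjugate
            = (A : Matrix (Fin n) (Fin n) K).adjugate * (A : Matrix (Fin n) (Fin n) K) *
              ((A⁻¹ : GL (Fin n) K) : Matrix (Fin n) (Fin n) K) := by
              rw [mul_assoc, ← Units.val_mul, mul_inv_cancel, Units.val_one, mul_one]
          _ = _ := by rw [Matrix.adjugate_mul, Matrix.smul_mul, one_mul]
      rw [map_mul, hadj, hinv, h, map_mul, eval_X]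
      simp only [matOf, Sum.elim_inr, Matrix.smul_apply, smul_eq_mul]
      ring

lemma det_ne_zero (A : GL (Fin n) K) : (A : Matrix (Fin n) (Fin n) K).det ≠ 0 :=
  ((Matrix.isUnit_iff_isUnit_det _).1 A.isUnit).ne_zero

lemma mem_of_isZClosed {s : Set (GL (Fin n) K)} (hs : IsZClosed s) {A : GL (Fin n) K}
    (hA : ∀ p ∈ vanish s, ev (A : Matrix (Fin n) (Fin n) K) p = 0) : A ∈ s := by
  obtain ⟨I, hI⟩ := hs
  rw [hI]
  intro p hp
  obtain ⟨N, q, hq⟩ := exists_clear_denominators p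
  have h0 := hA q (fun B hB => by
    rw [hI] at hB
    rw [hq, hB p hp, mul_zero])
  rw [hq] at h0
  exact (mul_eq_zero.1 h0).resolve_left (pow_ne_zero _ (det_ne_zero A))

lemma isZClosed_zeroLocus (I : Set (MvPolynomial (Fin n × Fin n) K)) :
    IsZClosed {A : GL (Fin n) K | ∀ p ∈ I, ev (A : Matrix (Fin n) (Fin n) K) p = 0} := by
  refine ⟨rename Sum.inl '' I, ?_⟩
  have h (A : GL (Fin n) K) (p : MvPolynomial (Fin n × Fin n) K) :
      eval (matOf A) (rename Sum.inl p) = ev (A : Matrix (Fin n) (Fin n) K) p := by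
    rw [eval_rename]; rfl
  ext A
  simp [h]

lemma IsZClosed.inter {s t : Set (GL (Fin n) K)} (hs : IsZClosed s) (ht : IsZClosed t) :
    IsZClosed (s ∩ t) := by
  obtain ⟨I, rfl⟩ := hs
  obtain ⟨J, rfl⟩ := ht
  refine ⟨I ∪ J, ?_⟩
  ext A
  simp only [Set.mem_inter_iff, Set.mem_ofPred_eq, Set.mem_union]
  exact ⟨fun h p hp => hp.elim (h.1 p) (h.2 p), fun h => ⟨fun p hp => h p (.inl hp),
    fun p hp => h p (.inr hp)⟩⟩

/-- Invertible matrices which differ from the identity by an element of a fixed linear subspace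
form a closed set. -/
lemma isZClosed_sub_one_mem (E : Submodule K (Matrix (Fin n) (Fin n) K)) :
    IsZClosed {A : GL (Fin n) K | (A : Matrix (Fin n) (Fin n) K) - 1 ∈ E} := by
  have hE : {A : GL (Fin n) K | (A : Matrix (Fin n) (Fin n) K) - 1 ∈ E} =
      {A : GL (Fin n) K | ∀ p ∈ (fun ℓ : Module.Dual K (Matrix (Fin n) (Fin n) K) =>
        ∑ i, ∑ j, C (ℓ (Matrix.single i j 1)) * (X (i, j) - C ((1 : Matrix (Fin n) (Fin n) K) i j)))
        '' (E.dualAnnihilator : Set (Module.Dual K (Matrix (Fin n) (Fin n) K))),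
          ev (A : Matrix (Fin n) (Fin n) K) p = 0} := by
    ext A
    simp only [Set.mem_ofPred_eq, Set.forall_mem_image, SetLike.mem_coe]
    rw [← Subspace.dualAnnihilator_dualCoannihilator_eq (W := E), Submodule.mem_dualCoannihilator,
      Subspace.dualAnnihilator_dualCoannihilator_eq]
    refine forall₂_congr fun ℓ _ => ?_
    conv_lhs => rw [matrix_eq_sum_single ((A : Matrix (Fin n) (Fin n) K) - 1)]
    have (i j : Fin n) (c : K) : Matrix.single i j c = c • Matrix.single i j (1 : K) := by simp
    simp only [map_sum, map_mul, map_sub, ev_X, ev_C]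
    rw [show (∑ i, ∑ j, ℓ (Matrix.single i j (((A : Matrix (Fin n) (Fin n) K) - 1) i j)) = 0) ↔ _
      from Iff.of_eq (congrArg (· = (0 : K)) (Finset.sum_congr rfl fun i _ =>
        Finset.sum_congr rfl fun j _ => by rw [this, map_smul, smul_eq_mul, mul_comm]))]
    rfl
  rw [hE]
  exact isZClosed_zeroLocus _

/-- The Zariski closure of a subgroup. -/
def zclosure (B : Subgroup (GL (Fin n) K)) : Subgroup (GL (Fin n) K) where
  carrier := {A | ∀ p ∈ vanish (B : Set (GL (Fin n) K)), ev (A : Matrix (Fin n) (Fin n) K) p = 0}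
  one_mem' p hp := hp 1 B.one_mem
  mul_mem' {A A'} hA hA' p hp := by
    rw [Set.mem_ofPred_eq] at hA hA'
    have h := hA (rtrans (A' : Matrix (Fin n) (Fin n) K) p) (fun b hb => by
      have h' := hA' (ltrans (b : Matrix (Fin n) (Fin n) K) p) (fun b' hb' => by
        rw [ev_ltrans]
        exact hp (b * b') (B.mul_mem hb hb'))
      rw [ev_ltrans] at h'
      rw [ev_rtrans]
      exact h')
    rw [ev_rtrans] at h
    exact h
  inv_mem' {A} hA p hp := by
    rw [Set.mem_ofPred_eq] at hA
    have h (A : GL (Fin n) K) : eval (matOf A) (rename Sum.inr p) =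
        ev ((A⁻¹ : GL (Fin n) K) : Matrix (Fin n) (Fin n) K) p := by
      rw [eval_rename]; rfl
    obtain ⟨N, q, hq⟩ := exists_clear_denominators (rename Sum.inr p)
    have h0 := hA q (fun b hb => by rw [hq, h, hp _ (B.inv_mem hb), mul_zero])
    rw [hq, h] at h0
    exact (mul_eq_zero.1 h0).resolve_left (pow_ne_zero _ (det_ne_zero A))

lemma isZClosed_zclosure (B : Subgroup (GL (Fin n) K)) :
    IsZClosed (zclosure B : Set (GL (Fin n) K)) := isZClosed_zeroLocus _

lemma le_zclosure (B : Subgroup (GL (Fin n) K)) : B ≤ zclosure B := fun A hA _ hp => hp A hA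

lemma zclosure_subset {B : Subgroup (GL (Fin n) K)} {s : Set (GL (Fin n) K)} (hs : IsZClosed s)
    (hB : (B : Set (GL (Fin n) K)) ⊆ s) : (zclosure B : Set (GL (Fin n) K)) ⊆ s :=
  fun _ hA => mem_of_isZClosed hs fun p hp => hA p fun b hb => hp b (hB hb)

lemma isConnectedSG_zclosure {B : Subgroup (GL (Fin n) K)} (hB : IsConnectedSG B) :
    IsConnectedSG (zclosure B) := by
  intro s t hs ht hst h0
  have hsub : (B : Set (GL (Fin n) K)) ⊆ zclosure B := le_zclosure B
  rcases hB s t hs ht (hsub.trans hst) (by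
    rw [← Set.subset_empty_iff, ← h0]
    exact fun A hA => ⟨⟨hsub hA.1.1, hA.1.2⟩, hA.2⟩) with h | h
  · exact .inl (zclosure_subset hs h)
  · exact .inr (zclosure_subset ht h)

end GLZariski

namespace GLZariski

section ExponentialPolynomials

variable {M : Type*} [CommMonoid M]

lemma injective_of_mem_maxGenEigenspace {R : Type*} [CommRing R] [Algebra K R]
    (Φ : MonoidAlgebra (Polynomial K) M →ₐ[K] R) (d : Module.End K R) {μ : M → K}
    (hμ : Function.Injective μ)
    (h : ∀ m q, Φ (MonoidAlgebra.single m q) ∈ d.maxGenEigenspace (μ m))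
    (h0 : ∀ m q, Φ (MonoidAlgebra.single m q) = 0 → q = 0) : Function.Injective Φ := by
  rw [injective_iff_map_eq_zero]
  intro x hx
  have hind := (Module.End.independent_maxGenEigenspace d).comp hμ
  rw [← x.sum_coeff_single, Finsupp.sum, map_sum] at hx
  have key := (iSupIndep_iff_finsetSum_eq_zero_imp_eq_zero _).1 hind x.coeff.support
    (fun m => Φ (MonoidAlgebra.single m (x.coeff m))) (fun m _ => h m _) hx
  rw [← x.sum_coeff_single, Finsupp.sum]
  refine Finset.sum_eq_zero fun m hm => ?_
  rw [h0 m _ (key m hm), MonoidAlgebra.single_zero]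

/-- Exponential polynomials as sequences. -/
noncomputable def toSeq (χ : M →* K) : MonoidAlgebra (Polynomial K) M →ₐ[K] (ℕ → K) :=
  MonoidAlgebra.liftNCAlgHom (Polynomial.aeval fun k : ℕ => (k : K))
    ⟨⟨fun m k => χ m ^ k, by ext; simp⟩, fun a b => by ext; simp [mul_pow]⟩
    fun _ _ => Commute.all _ _

lemma toSeq_single (χ : M →* K) (m : M) (q : Polynomial K) (k : ℕ) :
    toSeq χ (MonoidAlgebra.single m q) k = q.eval (k : K) * χ m ^ k := by
  have h : Polynomial.aeval (fun k : ℕ => (k : K)) q k = q.eval (k : K) := by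
    have := Polynomial.aeval_algHom_apply (Pi.evalAlgHom K (fun _ : ℕ => K) k)
      (fun k : ℕ => (k : K)) q
    rw [Pi.evalAlgHom_apply, Pi.evalAlgHom_apply, Polynomial.coe_aeval_eq_eval] at this
    exact this.symm
  simp [toSeq, MonoidAlgebra.liftNC_single, h]

lemma toSeq_injective [CharZero K] {χ : M →* K} (hχ : Function.Injective χ)
    (hχ0 : ∀ m, χ m ≠ 0) : Function.Injective (toSeq χ) := by
  refine injective_of_mem_maxGenEigenspace _ (LinearMap.funLeft K K Nat.succ) hχ ?_ ?_
  · intro m q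
    rw [Module.End.mem_maxGenEigenspace]
    have key : ∀ N : ℕ, ∀ q : Polynomial K, q.degree < N →
        ((LinearMap.funLeft K K Nat.succ - χ m • 1) ^ N)
          (toSeq χ (MonoidAlgebra.single m q)) = 0 := by
      intro N
      induction N with
      | zero =>
        intro q hq
        have : q = 0 := by
          rw [← Polynomial.degree_eq_bot]
          simpa using hq
        simp [this]
      | succ N ih =>
        intro q hq
        by_cases hq0 : q = 0
        · simp [hq0]
        have hstep : (LinearMap.funLeft K K Nat.succ - χ m • 1 : Module.End K (ℕ → K))
            (toSeq χ (MonoidAlgebra.single m q)) =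
            toSeq χ (MonoidAlgebra.single m
              (Polynomial.C (χ m) * (Polynomial.taylor 1 q - q))) := by
          ext k
          simp only [LinearMap.sub_apply, LinearMap.smul_apply, Module.End.one_apply, Pi.sub_apply,
            Pi.smul_apply, LinearMap.funLeft_apply, toSeq_single, smul_eq_mul, Polynomial.eval_mul,
            Polynomial.eval_C, Polynomial.eval_sub, Polynomial.taylor_eval, Nat.cast_succ, pow_succ]
          ring
        rw [pow_succ, Module.End.mul_apply, hstep]
        refine ih _ ?_
        rw [Polynomial.degree_C_mul (hχ0 m)]
        have h1 := Polynomial.degree_sub_lt_left (Polynomial.degree_taylor q 1)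
          (by rwa [Ne, Polynomial.taylor_eq_zero]) (Polynomial.leadingCoeff_taylor ..)
        rw [Polynomial.degree_taylor] at h1
        have h2 : q.degree ≤ N := by
          rw [Polynomial.degree_eq_natDegree hq0] at hq ⊢
          exact_mod_cast Nat.lt_succ_iff.1 (by exact_mod_cast hq)
        exact h1.trans_le h2
    exact ⟨q.natDegree + 1, key _ q (lt_of_le_of_lt Polynomial.degree_le_natDegree
      (by exact_mod_cast Nat.lt_succ_self _))⟩
  · intro m q h
    refine Polynomial.eq_zero_of_infinite_isRoot q
      ((Set.infinite_range_of_injective (Nat.cast_injective (R := K))).mono ?_)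
    rintro _ ⟨k, rfl⟩
    have := congrFun h k
    rw [toSeq_single, Pi.zero_apply] at this
    exact (mul_eq_zero.1 this).resolve_right (pow_ne_zero _ (hχ0 m))

variable [CharZero K]

/-- Exponential polynomials as power series. -/
noncomputable def toPow (θ : M →* Multiplicative K) :
    MonoidAlgebra (Polynomial K) M →ₐ[K] PowerSeries K :=
  letI : Algebra ℚ K := DivisionRing.toRatAlgebra
  MonoidAlgebra.liftNCAlgHom (Polynomial.coeToPowerSeries.algHom K)
    ⟨⟨fun m => PowerSeries.rescale (θ m).toAdd (PowerSeries.exp K), by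
      ext k; cases k <;> simp⟩, fun a b => by
      simp [← PowerSeries.exp_mul_exp_eq_exp_add]⟩
    fun _ _ => Commute.all _ _

lemma toPow_single (θ : M →* Multiplicative K) (m : M) (q : Polynomial K) :
    toPow θ (MonoidAlgebra.single m q) =
      (q : PowerSeries K) * PowerSeries.rescale (θ m).toAdd (PowerSeries.exp K) := by
  simp [toPow, MonoidAlgebra.liftNC_single]

lemma derivative_rescale_exp (c : K) :
    PowerSeries.derivative K (PowerSeries.rescale c (PowerSeries.exp K)) =
      c • PowerSeries.rescale c (PowerSeries.exp K) := by
  ext k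
  rw [PowerSeries.coeff_derivative, PowerSeries.coeff_rescale, PowerSeries.coeff_smul,
    PowerSeries.coeff_rescale, PowerSeries.coeff_exp, PowerSeries.coeff_exp]
  have : ((k : K) + 1) ≠ 0 := by exact_mod_cast Nat.succ_ne_zero k
  have h2 : (k.factorial : K) ≠ 0 := by exact_mod_cast Nat.factorial_ne_zero k
  simp only [map_div₀, map_one, map_natCast, Nat.factorial_succ, Nat.cast_mul, smul_eq_mul]
  push_cast
  field_simp
  ring

lemma toPow_injective {θ : M →* Multiplicative K} (hθ : Function.Injective θ) :
    Function.Injective (toPow θ) := by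
  refine injective_of_mem_maxGenEigenspace _ (PowerSeries.derivative K).toLinearMap
    (μ := fun m => (θ m).toAdd) hθ ?_ ?_
  · intro m q
    rw [Module.End.mem_maxGenEigenspace]
    have hstep : ∀ q : Polynomial K,
        ((PowerSeries.derivative K).toLinearMap - (θ m).toAdd • 1 : Module.End K (PowerSeries K))
          (toPow θ (MonoidAlgebra.single m q)) =
        toPow θ (MonoidAlgebra.single m (Polynomial.derivative q)) := by
      intro q
      simp only [LinearMap.sub_apply, LinearMap.smul_apply, Module.End.one_apply, toPow_single,
        Derivation.coeFn_coe, Derivation.leibniz, derivative_rescale_exp, smul_eq_mul,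
        PowerSeries.derivative_coe, PowerSeries.smul_eq_C_mul]
      ring
    have key : ∀ N : ℕ, (((PowerSeries.derivative K).toLinearMap - (θ m).toAdd • 1) ^ N :
          Module.End K (PowerSeries K)) (toPow θ (MonoidAlgebra.single m q)) =
        toPow θ (MonoidAlgebra.single m (Polynomial.derivative^[N] q)) := by
      intro N
      induction N with
      | zero => simp
      | succ N ih => rw [pow_succ', Module.End.mul_apply, ih, hstep, Function.iterate_succ_apply']
    refine ⟨q.natDegree + 1, ?_⟩
    rw [key, Polynomial.iterate_derivative_eq_zero (Nat.lt_succ_self _), MonoidAlgebra.single_zero,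
      map_zero]
  · intro m q h
    rw [toPow_single] at h
    have hne : PowerSeries.rescale (θ m).toAdd (PowerSeries.exp K) ≠ 0 := by
      intro h0
      have := congrArg (PowerSeries.coeff 0) h0
      simp [PowerSeries.coeff_rescale] at this
    exact_mod_cast (mul_eq_zero.1 h).resolve_right hne

end ExponentialPolynomials

end GLZariski

namespace GLZariski

section Diagonalization

variable {n : ℕ}

/-- Simultaneous diagonalization of commuting semisimple matrices. -/
lemma exists_simultaneous_diagonalization [IsAlgClosed K] (s : Set (Matrix (Fin n) (Fin n) K))
    (hs : ∀ A ∈ s, Module.End.IsSemisimple (toLin' A)) (hc : ∀ A ∈ s, ∀ B ∈ s, Commute A B) :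
    ∃ Q Q' : Matrix (Fin n) (Fin n) K, Q * Q' = 1 ∧
      ∀ A ∈ s, ∃ d : Fin n → K, A = Q * diagonal d * Q' := by
  let f : s → Module.End K (Fin n → K) := fun A => toLin' A.1
  have htop :=
    Module.End.iSup_iInf_maxGenEigenspace_eq_top_of_iSup_maxGenEigenspace_eq_top_of_commute
    f (fun A B _ => (hc A.1 A.2 B.1 B.2).map toLinAlgEquiv') fun A =>
      Module.End.iSup_maxGenEigenspace_eq_top _
  let v : Set (Fin n → K) := {v | ∀ A ∈ s, ∃ μ : K, A *ᵥ v = μ • v}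
  have hv : ⊤ ≤ Submodule.span K v := by
    rw [← htop, iSup_le_iff]
    intro χ x hx
    refine Submodule.subset_span fun A hA => ⟨χ ⟨A, hA⟩, ?_⟩
    have h := (Submodule.mem_iInf _).1 hx ⟨A, hA⟩
    rw [(hs A hA).isFinitelySemisimple.maxGenEigenspace_eq_eigenspace,
      Module.End.mem_eigenspace_iff] at h
    exact h
  obtain ⟨ι, b₀, hb₀⟩ : ∃ (ι : Type) (b : Module.Basis ι K (Fin n → K)), Set.range b ⊆ v :=
    ⟨_, Module.Basis.ofSpan hv, Module.Basis.ofSpan_subset hv⟩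
  have : Fintype ι := FiniteDimensional.fintypeBasisIndex b₀
  let e : ι ≃ Fin n := Fintype.equivOfCardEq (by
    rw [← Module.finrank_eq_card_basis b₀, Module.finrank_fin_fun, Fintype.card_fin])
  let b := b₀.reindex e
  have hb : ∀ j, b j ∈ v := fun j => by
    rw [Module.Basis.reindex_apply]
    exact hb₀ ⟨_, rfl⟩
  refine ⟨(Pi.basisFun K (Fin n)).toMatrix b, b.toMatrix (Pi.basisFun K (Fin n)),
    Module.Basis.toMatrix_mul_toMatrix_flip _ _, fun A hA => ?_⟩
  choose d hd using fun j => hb j A hA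
  refine ⟨d, ?_⟩
  have h : A * (Pi.basisFun K (Fin n)).toMatrix b =
      (Pi.basisFun K (Fin n)).toMatrix b * diagonal d := by
    ext i j
    have := congrFun (hd j) i
    rw [mul_diagonal, Matrix.mul_apply]
    simpa [mulVec, dotProduct, Module.Basis.toMatrix_apply, mul_comm] using this
  rw [← h, mul_assoc, Module.Basis.toMatrix_mul_toMatrix_flip, mul_one]

lemma isSemisimple_conj_diagonal {Q Q' : Matrix (Fin n) (Fin n) K} (hQ : Q * Q' = 1)
    (d : Fin n → K) : Module.End.IsSemisimple (toLin' (Q * diagonal d * Q')) := by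
  classical
  let φ : (Fin n → K) →ₐ[K] Module.End K (Fin n → K) := toLinAlgEquiv'.toAlgHom.comp
    (AlgHom.ofLinearMap
      { toFun := fun d => Q * diagonal d * Q'
        map_add' := fun a b => by
          rw [Pi.add_def, ← diagonal_add, mul_add, add_mul]
        map_smul' := fun a b => by simp [diagonal_smul] }
      (by simp [hQ]) fun a b => by
        simp only [LinearMap.coe_mk, AddHom.coe_mk]
        rw [Pi.mul_def, ← diagonal_mul_diagonal]
        simp only [mul_assoc]
        rw [← mul_assoc Q' Q, mul_eq_one_comm.1 hQ, one_mul])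
  let p : Polynomial K := ∏ μ ∈ Finset.univ.image d, (Polynomial.X - Polynomial.C μ)
  refine Module.End.isSemisimple_of_squarefree_aeval_eq_zero (p := p)
    (Polynomial.separable_prod_X_sub_C_iff'.2 fun _ _ _ _ h => h).squarefree ?_
  change Polynomial.aeval (φ d) p = 0
  rw [Polynomial.aeval_algHom_apply]
  convert map_zero φ
  ext i
  have := Polynomial.aeval_algHom_apply (Pi.evalAlgHom K (fun _ : Fin n => K) i) d p
  rw [Pi.evalAlgHom_apply, Pi.evalAlgHom_apply, Polynomial.coe_aeval_eq_eval] at this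
  rw [← this, Polynomial.eval_prod]
  exact Finset.prod_eq_zero (Finset.mem_image_of_mem d (Finset.mem_univ i)) (by simp)

lemma pow_eq_zero_of_isNilpotent {A : Matrix (Fin n) (Fin n) K} (hA : IsNilpotent A) :
    A ^ n = 0 := by
  have h := sub_eq_zero.1 (Matrix.isNilpotent_charpoly_sub_pow_of_isNilpotent hA).eq_zero
  have h2 := A.aeval_self_charpoly
  rwa [h, map_pow, Polynomial.aeval_X, Fintype.card_fin] at h2

/-- Jordan decomposition of matrices. -/
lemma exists_jordan_decomposition [IsAlgClosed K] [CharZero K] (A : Matrix (Fin n) (Fin n) K) :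
    ∃ (Q Q' : Matrix (Fin n) (Fin n) K) (d : Fin n → K) (N : Matrix (Fin n) (Fin n) K),
      Q * Q' = 1 ∧ A = Q * diagonal d * Q' + N ∧ N ^ n = 0 ∧
      (∀ B, Commute B A → Commute B (Q * diagonal d * Q')) ∧ ∀ B, Commute B A → Commute B N := by
  obtain ⟨ν, hν, σ, hσ, hnil, hss, h⟩ :=
    Module.End.exists_isNilpotent_isSemisimple (f := toLin' A)
  obtain ⟨Q, Q', hQ, hd⟩ := exists_simultaneous_diagonalization {LinearMap.toMatrix' σ}
    (by simpa using hss) (by simp)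
  obtain ⟨d, hd⟩ := hd _ rfl
  have hcomm : ∀ τ ∈ Algebra.adjoin K {toLin' A}, ∀ B, Commute B A →
      Commute B (LinearMap.toMatrix' τ) := by
    intro τ hτ B hB
    have := Algebra.commute_of_mem_adjoin_singleton_of_commute hτ (hB.map toLinAlgEquiv')
    have h2 := this.map LinearMap.toMatrixAlgEquiv'
    rwa [LinearMap.toMatrixAlgEquiv'_toLinAlgEquiv'] at h2
  refine ⟨Q, Q', d, LinearMap.toMatrix' ν, hQ, ?_, ?_, ?_, hcomm ν hν⟩
  · rw [← hd, ← map_add, add_comm, ← h, LinearMap.toMatrix'_toLin']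
  · exact pow_eq_zero_of_isNilpotent (hnil.map LinearMap.toMatrixAlgEquiv')
  · rw [← hd]; exact hcomm σ hσ

/-- A matrix commuting with a diagonalizable one commutes with functions of it. -/
lemma commute_conj_diagonal_iff {Q Q' : Matrix (Fin n) (Fin n) K} (hQ : Q * Q' = 1) (c : Fin n → K)
    {B : Matrix (Fin n) (Fin n) K} : Commute B (Q * diagonal c * Q') ↔
      ∀ i j, (Q' * B * Q) i j * c j = c i * (Q' * B * Q) i j := by
  have hQ' := mul_eq_one_comm.1 hQ
  have h1 : Commute B (Q * diagonal c * Q') ↔ Commute (Q' * B * Q) (diagonal c) := by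
    constructor
    · intro h
      calc Q' * B * Q * diagonal c = Q' * (B * (Q * diagonal c * Q')) * Q := by
            simp only [mul_assoc, hQ', mul_one]
        _ = diagonal c * (Q' * B * Q) := by
            rw [h.eq]
            simp only [← mul_assoc, hQ', one_mul]
    · intro h
      calc B * (Q * diagonal c * Q') = Q * (Q' * B * Q * diagonal c) * Q' := by
            simp only [← mul_assoc, hQ, one_mul]
        _ = Q * diagonal c * Q' * B := by
            rw [h.eq]
            simp only [mul_assoc, hQ, mul_one]
  rw [h1, Commute, SemiconjBy, ← Matrix.ext_iff]
  simp only [mul_diagonal, diagonal_mul]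

lemma commute_conj_diagonal_comp {Q Q' : Matrix (Fin n) (Fin n) K} (hQ : Q * Q' = 1)
    {d e : Fin n → K} (hde : ∀ i j, d i = d j → e i = e j) {B : Matrix (Fin n) (Fin n) K}
    (hB : Commute B (Q * diagonal d * Q')) : Commute B (Q * diagonal e * Q') := by
  rw [commute_conj_diagonal_iff hQ] at hB ⊢
  intro i j
  by_cases h0 : (Q' * B * Q) i j = 0
  · simp [h0]
  · have := hB i j
    rw [mul_comm] at this
    rw [hde i j (mul_right_cancel₀ h0 this).symm, mul_comm]

end Diagonalization

end GLZariski

namespace GLZariski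

section Curves

variable {n : ℕ}

/-- The product of the diagonalizable matrix with eigenvalues `e` in the eigenbasis `Q` and of a
polynomial in the matrix `N`. -/
noncomputable def curve {R : Type*} [CommRing R] [Algebra K R] (Q Q' N : Matrix (Fin n) (Fin n) K)
    (e : Fin n → R) (c : ℕ → R) : Matrix (Fin n) (Fin n) R :=
  Q.map (algebraMap K R) * diagonal e * Q'.map (algebraMap K R) *
    ∑ k ∈ Finset.range (n + 2), c k • (N ^ k).map (algebraMap K R)

lemma map_curve {R S : Type*} [CommRing R] [Algebra K R] [CommRing S] [Algebra K S]
    (φ : R →ₐ[K] S) (Q Q' N : Matrix (Fin n) (Fin n) K) (e : Fin n → R) (c : ℕ → R) :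
    (curve Q Q' N e c).map φ = curve Q Q' N (fun i => φ (e i)) fun k => φ (c k) := by
  have h1 (A : Matrix (Fin n) (Fin n) K) :
      φ.toRingHom.mapMatrix (A.map (algebraMap K R)) = A.map (algebraMap K S) := by
    ext i j; simp
  change φ.toRingHom.mapMatrix (curve Q Q' N e c) = _
  rw [curve, map_mul, map_mul, map_mul, h1, h1, map_sum, curve]
  congr 2
  · congr 2
    ext i j
    by_cases h : i = j <;> simp [diagonal, h]
  · funext k
    rw [← h1]
    ext i j
    simp

lemma curve_self (Q Q' N : Matrix (Fin n) (Fin n) K) (e : Fin n → K) (c : ℕ → K) :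
    curve Q Q' N e c = Q * diagonal e * Q' * ∑ k ∈ Finset.range (n + 2), c k • N ^ k := by
  simp [curve]

lemma curve_one_left {R : Type*} [CommRing R] [Algebra K R] {Q Q' : Matrix (Fin n) (Fin n) K}
    (hQ : Q * Q' = 1) (N : Matrix (Fin n) (Fin n) K) (c : ℕ → R) :
    curve Q Q' N 1 c = ∑ k ∈ Finset.range (n + 2), c k • (N ^ k).map (algebraMap K R) := by
  rw [curve, Pi.one_def, diagonal_one, mul_one, ← Matrix.map_mul, hQ]
  simp

lemma curve_one_right (Q Q' N : Matrix (Fin n) (Fin n) K) (e : Fin n → K) {c : ℕ → K}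
    (h0 : c 0 = 1) (hc : ∀ k, k ≠ 0 → c k = 0) :
    curve Q Q' N e c = Q * diagonal e * Q' := by
  rw [curve_self, Finset.sum_eq_single 0 (fun k _ hk => by rw [hc k hk, zero_smul]) (by simp)]
  simp [h0]

section Specialization

variable {M : Type*} [CommMonoid M]

/-- Specialization of exponential polynomials. -/
noncomputable def spec {A : Type*} [CommRing A] [Algebra K A] (φ : Polynomial K →ₐ[K] A)
    (χ : M →* A) : MonoidAlgebra (Polynomial K) M →ₐ[K] A :=
  MonoidAlgebra.liftNCAlgHom φ χ fun _ _ => Commute.all _ _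

lemma spec_single {A : Type*} [CommRing A] [Algebra K A] (φ : Polynomial K →ₐ[K] A)
    (χ : M →* A) (m : M) (q : Polynomial K) :
    spec φ χ (MonoidAlgebra.single m q) = φ q * χ m := by
  simp [spec, MonoidAlgebra.liftNC_single]

/-- The universal exponential-polynomial curve. -/
noncomputable def expCurve (Q Q' N : Matrix (Fin n) (Fin n) K) (m : Fin n → M)
    (c : ℕ → Polynomial K) : Matrix (Fin n) (Fin n) (MonoidAlgebra (Polynomial K) M) :=
  curve Q Q' N (fun i => MonoidAlgebra.single (m i) 1) fun k => MonoidAlgebra.single 1 (c k)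

lemma spec_ev_expCurve (Q Q' N : Matrix (Fin n) (Fin n) K) (m : Fin n → M)
    (c : ℕ → Polynomial K) {A : Type*} [CommRing A] [Algebra K A] (φ : Polynomial K →ₐ[K] A)
    (χ : M →* A) (p : MvPolynomial (Fin n × Fin n) K) :
    spec φ χ (ev (expCurve Q Q' N m c) p) =
      ev (curve Q Q' N (fun i => χ (m i)) fun k => φ (c k)) p := by
  rw [map_ev, expCurve, map_curve]
  simp [spec_single]

lemma toSeq_ev_expCurve (Q Q' N : Matrix (Fin n) (Fin n) K) (m : Fin n → M)
    (c : ℕ → Polynomial K) (χ : M →* K) (p : MvPolynomial (Fin n × Fin n) K) (k : ℕ) :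
    toSeq χ (ev (expCurve Q Q' N m c) p) k =
      ev (curve Q Q' N (fun i => χ (m i) ^ k) fun j => (c j).eval (k : K)) p := by
  have := map_ev ((Pi.evalAlgHom K (fun _ : ℕ => K) k).comp (toSeq χ)) (expCurve Q Q' N m c) p
  rw [expCurve, map_curve] at this
  simpa [toSeq_single, expCurve] using this

lemma ev_expCurve_eq_zero [CharZero K] {Q Q' N : Matrix (Fin n) (Fin n) K} {m : Fin n → M}
    {c : ℕ → Polynomial K} {χ : M →* K} (hχ : Function.Injective χ) (hχ0 : ∀ m, χ m ≠ 0)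
    {p : MvPolynomial (Fin n × Fin n) K}
    (hp : ∀ k : ℕ,
      ev (curve Q Q' N (fun i => χ (m i) ^ k) fun j => (c j).eval (k : K)) p = 0) :
    ev (expCurve Q Q' N m c) p = 0 := by
  refine toSeq_injective hχ hχ0 ?_
  ext k
  rw [toSeq_ev_expCurve, hp, map_zero, Pi.zero_apply]

end Specialization

lemma map_derivation_mul {R : Type*} [CommRing R] [Algebra K R] (δ : Derivation K R R)
    (A B : Matrix (Fin n) (Fin n) R) : (A * B).map δ = A.map δ * B + A * B.map δ := by
  ext i j
  simp only [Matrix.map_apply, Matrix.mul_apply, Matrix.add_apply, map_sum, Derivation.leibniz,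
    smul_eq_mul, Finset.sum_add_distrib]
  rw [add_comm]
  simp only [mul_comm]

lemma map_derivation_algebraMap {R : Type*} [CommRing R] [Algebra K R] (δ : Derivation K R R)
    (A : Matrix (Fin n) (Fin n) K) : (A.map (algebraMap K R)).map δ = 0 := by
  ext i j; simp

/-- The derivative of `exp (t S) exp (t N)`. -/
lemma map_derivation_curve {R : Type*} [CommRing R] [Algebra K R] (δ : Derivation K R R)
    {Q Q' N : Matrix (Fin n) (Fin n) K} {e : Fin n → R} {c : ℕ → R} {d : Fin n → K}
    (hQ : Q * Q' = 1) (hN : N ^ n = 0) (hSN : Commute (Q * diagonal d * Q') N)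
    (he : ∀ i, δ (e i) = d i • e i) (hc0 : δ (c 0) = 0) (hc : ∀ k, δ (c (k + 1)) = c k) :
    (curve Q Q' N e c).map δ =
      curve Q Q' N e c * (Q * diagonal d * Q' + N).map (algebraMap K R) := by
  set a := (algebraMap K R).mapMatrix (m := Fin n) with ha
  have ha' : ∀ A, A.map (algebraMap K R) = a A := fun _ => rfl
  have hU : (∑ k ∈ Finset.range (n + 2), c k • a (N ^ k)).map δ =
      (∑ k ∈ Finset.range (n + 2), c k • a (N ^ k)) * a N := by
    have h1 : (∑ k ∈ Finset.range (n + 2), c k • a (N ^ k)).map δ =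
        ∑ k ∈ Finset.range (n + 2), δ (c k) • a (N ^ k) := by
      ext i j
      simp [ha, Matrix.sum_apply, mul_comm]
    rw [h1, Finset.sum_range_succ', hc0, zero_smul, add_zero, Finset.sum_mul,
      Finset.sum_range_succ _ (n + 1)]
    have h2 : c (n + 1) • a (N ^ (n + 1)) * a N = 0 := by
      rw [pow_succ, hN]; simp
    rw [h2, add_zero]
    refine Finset.sum_congr rfl fun k _ => ?_
    rw [hc, smul_mul_assoc, ← map_mul, pow_succ]
  have hD : (diagonal e).map δ = diagonal e * a (diagonal d) := by
    ext i j
    by_cases h : i = j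
    · subst h
      simp [ha, he, Algebra.smul_def, mul_comm]
    · simp [ha, diagonal_apply_ne _ h]
  have hcomm : Commute (a (Q * diagonal d * Q')) (∑ k ∈ Finset.range (n + 2), c k • a (N ^ k)) :=
    Commute.sum_right _ _ _ fun k _ => ((hSN.pow_right k).map a).smul_right _
  have hQ2 : a Q' * a Q = 1 := by rw [← map_mul, mul_eq_one_comm.1 hQ, map_one]
  rw [curve]
  simp only [ha']
  rw [map_derivation_mul, map_derivation_mul, map_derivation_mul, hU, hD]
  simp only [← ha', map_derivation_algebraMap]
  simp only [ha', zero_mul, mul_zero, zero_add, add_zero, map_add, mul_add]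
  congr 1
  · rw [mul_assoc _ _ (a (Q * diagonal d * Q')), ← hcomm.eq, map_mul, map_mul]
    simp only [← mul_assoc]
    rw [mul_assoc _ (a Q') (a Q), hQ2, mul_one]
  · simp only [mul_assoc]

end Curves

end GLZariski

namespace GLZariski

section OneParameter

variable {n : ℕ}

lemma exists_mem_eq {H : Subgroup (GL (Fin n) K)} (hH : IsZClosed (H : Set (GL (Fin n) K)))
    {F : Matrix (Fin n) (Fin n) K} (hF : ∀ p ∈ vanish (H : Set (GL (Fin n) K)), ev F p = 0)
    (hu : IsUnit F) : ∃ A ∈ H, (A : Matrix (Fin n) (Fin n) K) = F := by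
  obtain ⟨A, rfl⟩ := hu
  exact ⟨A, mem_of_isZClosed hH hF, rfl⟩

/-- The binomial coefficient `t ↦ t.choose j` as a polynomial. -/
noncomputable def binomPoly (K : Type) [Field K] (j : ℕ) : Polynomial K :=
  Polynomial.C (j.factorial : K)⁻¹ * descPochhammer K j

lemma eval_binomPoly [CharZero K] (j k : ℕ) : (binomPoly K j).eval (k : K) = k.choose j := by
  have h : (j.factorial : K) ≠ 0 := by exact_mod_cast j.factorial_ne_zero
  rw [binomPoly, Polynomial.eval_mul, Polynomial.eval_C, descPochhammer_eval_eq_descFactorial,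
    Nat.descFactorial_eq_factorial_mul_choose, Nat.cast_mul, inv_mul_cancel_left₀ h]

/-- The coefficients `t ^ k / k!` of the exponential. -/
noncomputable def expPoly (K : Type) [Field K] (k : ℕ) : Polynomial K :=
  Polynomial.C (k.factorial : K)⁻¹ * Polynomial.X ^ k

lemma expPoly_zero : expPoly K 0 = 1 := by simp [expPoly]

lemma eval_zero_expPoly {k : ℕ} (hk : k ≠ 0) : (expPoly K k).eval 0 = 0 := by
  simp [expPoly, hk]

lemma derivative_expPoly_succ [CharZero K] (k : ℕ) :
    Polynomial.derivative (expPoly K (k + 1)) = expPoly K k := by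
  have h : (k.factorial : K) ≠ 0 := by exact_mod_cast k.factorial_ne_zero
  have h1 : (k : K) + 1 ≠ 0 := by exact_mod_cast k.succ_ne_zero
  rw [expPoly, expPoly, Polynomial.derivative_C_mul, Polynomial.derivative_X_pow, ← mul_assoc,
    Nat.factorial_succ, Nat.add_sub_cancel, ← Polynomial.C_mul]
  congr 2
  push_cast
  field_simp

/-- The constant coefficient as an algebra homomorphism. -/
noncomputable def constCoeff (K : Type) [Field K] : PowerSeries K →ₐ[K] K :=
  { PowerSeries.constantCoeff (R := K) with
    commutes' := fun r => by simp }

lemma constCoeff_apply (f : PowerSeries K) : constCoeff K f = PowerSeries.coeff 0 f :=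
  (PowerSeries.coeff_zero_eq_constantCoeff_apply f).symm

lemma ev_eq_zero_of_derivative [CharZero K] {H : Subgroup (GL (Fin n) K)}
    {Y : Matrix (Fin n) (Fin n) K} (hY : Y ∈ lieOf (vanish (H : Set (GL (Fin n) K))))
    {F : Matrix (Fin n) (Fin n) (PowerSeries K)}
    (hF : F.map (PowerSeries.derivative K) = F * Y.map (algebraMap K _))
    (hF0 : F.map (constCoeff K) = 1)
    {p : MvPolynomial (Fin n × Fin n) K} (hp : p ∈ vanish (H : Set (GL (Fin n) K))) :
    ev F p = 0 := by
  have key : ∀ (k : ℕ), ∀ p ∈ vanish (H : Set (GL (Fin n) K)),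
      PowerSeries.coeff k (ev F p) = 0 := by
    intro k
    induction k with
    | zero =>
      intro p hp
      rw [← constCoeff_apply, map_ev, hF0]
      exact hp 1 H.one_mem
    | succ k ih =>
      intro p hp
      have h := map_derivation_ev (PowerSeries.derivative K) (AlgHom.id K _) F Y
        (by simpa using hF) p
      have h1 : (k : K) + 1 ≠ 0 := by exact_mod_cast k.succ_ne_zero
      have h2 := ih _ (hY p hp)
      have hid : F.map (AlgHom.id K (PowerSeries K)) = F := by ext; simp
      rw [hid] at h
      rw [← h, AlgHom.id_apply, PowerSeries.coeff_derivative] at h2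
      exact (mul_eq_zero.1 h2).resolve_right h1
  ext k
  rw [key k p hp, map_zero]

/-- The exponential curve attached to an element of the Lie algebra. -/
lemma ev_expCurve_eq_zero_of_mem_lieOf [CharZero K] {H : Subgroup (GL (Fin n) K)}
    {Q Q' N : Matrix (Fin n) (Fin n) K} {d : Fin n → K}
    (hQ : Q * Q' = 1) (hN : N ^ n = 0) (hSN : Commute (Q * diagonal d * Q') N)
    (hX : Q * diagonal d * Q' + N ∈ lieOf (vanish (H : Set (GL (Fin n) K))))
    {M : Type*} [CommMonoid M] {θ : M →* Multiplicative K} (hθ : Function.Injective θ)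
    {m : Fin n → M} (hm : ∀ i, (θ (m i)).toAdd = d i)
    {p : MvPolynomial (Fin n × Fin n) K} (hp : p ∈ vanish (H : Set (GL (Fin n) K))) :
    ev (expCurve Q Q' N m (expPoly K)) p = 0 := by
  refine toPow_injective hθ ?_
  rw [map_zero, map_ev]
  refine ev_eq_zero_of_derivative hX ?_ ?_ hp
  · rw [expCurve, map_curve]
    refine map_derivation_curve _ hQ hN hSN (fun i => ?_) ?_ fun k => ?_
    · simp [toPow_single, derivative_rescale_exp, hm]
    · simp [toPow_single, expPoly_zero]
    · simp [toPow_single, PowerSeries.derivative_coe, derivative_expPoly_succ]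
  · rw [expCurve, map_curve, map_curve]
    have h1 : ∀ i, constCoeff K (toPow θ (MonoidAlgebra.single (m i) 1)) = 1 := fun i => by
      simp [toPow_single, constCoeff_apply]
    have h2 : ∀ k, constCoeff K (toPow θ (MonoidAlgebra.single 1 (expPoly K k))) =
        (expPoly K k).eval 0 := fun k => by
      simp [toPow_single, constCoeff_apply, Polynomial.coeff_zero_eq_eval_zero]
    simp only [h1, h2]
    rw [curve_one_right _ _ _ _ (by simp [expPoly_zero]) fun k hk => eval_zero_expPoly hk,
      diagonal_one, mul_one, hQ]

lemma sum_binomPoly_smul_pow [CharZero K] {ν : Matrix (Fin n) (Fin n) K} (hνn : ν ^ n = 0) (k : ℕ) :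
    ∑ j ∈ Finset.range (n + 2), (binomPoly K j).eval (k : K) • ν ^ j = (1 + ν) ^ k := by
  rw [add_comm 1 ν, (Commute.one_right ν).add_pow]
  have h1 : ∀ s t : ℕ, (∀ j, s ≤ j → (k.choose j : K) • ν ^ j = 0) →
      ∑ j ∈ Finset.range (s + t), (k.choose j : K) • ν ^ j =
        ∑ j ∈ Finset.range s, (k.choose j : K) • ν ^ j := by
    intro s t hs
    rw [Finset.sum_range_add, Finset.sum_eq_zero (s := Finset.range t)
      (fun j _ => hs _ (Nat.le_add_right _ _)), add_zero]
  have h2 := h1 (n + 2) (k + 1) fun j hj => by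
    rw [pow_eq_zero_of_le (by omega : n ≤ j) hνn, smul_zero]
  have h3 := h1 (k + 1) (n + 2) fun j hj => by
    rw [Nat.choose_eq_zero_of_lt (by omega), Nat.cast_zero, zero_smul]
  simp only [eval_binomPoly]
  rw [← h2, add_comm (n + 2), h3]
  refine Finset.sum_congr rfl fun j _ => ?_
  rw [one_pow, mul_one, Nat.cast_smul_eq_nsmul, nsmul_eq_mul, Nat.cast_comm]

end OneParameter

/-- Powers of an invertible matrix through its Jordan decomposition. -/
lemma exists_curve_eq_pow [IsAlgClosed K] [CharZero K] (h : GL (Fin n) K) :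
    ∃ (Q Q' ν : Matrix (Fin n) (Fin n) K) (d : Fin n → Kˣ), Q * Q' = 1 ∧ ν ^ n = 0 ∧
      ∀ k : ℕ, curve Q Q' ν (fun i => (d i : K) ^ k) (fun j => (binomPoly K j).eval (k : K)) =
        (h : Matrix (Fin n) (Fin n) K) ^ k := by
  obtain ⟨Q, Q', d, N, hQ, hA, hN, hS, hNc⟩ :=
    exists_jordan_decomposition (h : Matrix (Fin n) (Fin n) K)
  have hQ' := mul_eq_one_comm.1 hQ
  have hNS : Commute N (Q * diagonal d * Q') := hS N (hNc _ (Commute.refl _)).symm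
  have hSu : IsUnit (Q * diagonal d * Q') := by
    have : Q * diagonal d * Q' = -N + (h : Matrix (Fin n) (Fin n) K) := by rw [hA]; abel
    rw [this]
    exact IsNilpotent.isUnit_add_right_of_commute ⟨n, by rw [neg_pow, hN, mul_zero]⟩ h.isUnit
      ((hNc _ (Commute.refl _)).symm.neg_left)
  have hd : ∀ i, d i ≠ 0 := by
    have h1 := ((Matrix.isUnit_iff_isUnit_det _).1 hSu).ne_zero
    rw [det_mul, det_mul, det_diagonal] at h1
    intro i hi
    exact h1 (by rw [Finset.prod_eq_zero (Finset.mem_univ i) hi]; ring)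
  have hconj : ∀ a b : Fin n → K, Q * diagonal a * Q' * (Q * diagonal b * Q') =
      Q * diagonal (a * b) * Q' := by
    intro a b
    rw [Pi.mul_def, ← diagonal_mul_diagonal]
    simp only [mul_assoc]
    rw [← mul_assoc Q' Q, hQ', one_mul]
  have hpow : ∀ (a : Fin n → K) (k : ℕ), (Q * diagonal a * Q') ^ k = Q * diagonal (a ^ k) * Q' := by
    intro a k
    induction k with
    | zero => simp [hQ]
    | succ k ih => rw [pow_succ, ih, hconj, pow_succ]
  have hNS' : Commute N (Q * diagonal d⁻¹ * Q') :=
    commute_conj_diagonal_comp hQ (fun i j hij => by simp [hij]) hNS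
  have hinv : Q * diagonal d * Q' * (Q * diagonal d⁻¹ * Q') = 1 := by
    rw [hconj]
    have : d * d⁻¹ = 1 := by ext i; simp [hd i]
    simp [this, hQ]
  set ν := Q * diagonal d⁻¹ * Q' * N with hν
  have hνn : ν ^ n = 0 := by rw [hν, hNS'.symm.mul_pow, hN, mul_zero]
  have hνS : Commute ν (Q * diagonal d * Q') :=
    Commute.mul_left (by rw [Commute, SemiconjBy, hconj, hconj, mul_comm]) hNS
  have hA' : (h : Matrix (Fin n) (Fin n) K) = Q * diagonal d * Q' * (1 + ν) := by
    rw [hA, mul_add, mul_one, hν, ← mul_assoc, hinv, one_mul]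
  refine ⟨Q, Q', ν, fun i => Units.mk0 (d i) (hd i), hQ, hνn, fun k => ?_⟩
  rw [hA', ((Commute.one_right _).add_right hνS.symm).mul_pow, hpow, curve_self,
    ← sum_binomPoly_smul_pow hνn]
  rfl

end GLZariski

namespace GLZariski

section Consequences

variable {n : ℕ}

lemma curve_zero (Q Q' : Matrix (Fin n) (Fin n) K) (e : Fin n → K) {c : ℕ → K} (h0 : c 0 = 1) :
    curve Q Q' 0 e c = Q * diagonal e * Q' := by
  rw [curve_self, Finset.sum_eq_single 0 (fun k _ hk => by rw [zero_pow hk, smul_zero]) (by simp)]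
  simp [h0]

lemma isUnit_sum_smul_pow {N : Matrix (Fin n) (Fin n) K} (hN : N ^ n = 0) {c : ℕ → K}
    (hc : c 0 = 1) : IsUnit (∑ k ∈ Finset.range (n + 2), c k • N ^ k) := by
  rw [Finset.sum_range_succ', hc, pow_zero, one_smul]
  refine IsNilpotent.isUnit_add_one ?_
  have : ∑ k ∈ Finset.range (n + 1), c (k + 1) • N ^ (k + 1) =
      N * ∑ k ∈ Finset.range (n + 1), c (k + 1) • N ^ k := by
    rw [Finset.mul_sum]
    exact Finset.sum_congr rfl fun k _ => by rw [mul_smul_comm, pow_succ']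
  rw [this]
  refine Commute.isNilpotent_mul_right ?_ ⟨n, hN⟩
  exact Commute.sum_right _ _ _ fun k _ => ((Commute.refl N).pow_right k).smul_right _

lemma isUnit_conj_diagonal {Q Q' : Matrix (Fin n) (Fin n) K} (hQ : Q * Q' = 1) (z : Fin n → Kˣ) :
    IsUnit (Q * diagonal (fun i => (z i : K)) * Q') := by
  refine IsUnit.of_mul_eq_one (Q * diagonal (fun i => (((z i)⁻¹ : Kˣ) : K)) * Q') ?_
  calc _ = Q * diagonal (fun i => (z i : K)) * (Q' * Q) *
        diagonal (fun i => (((z i)⁻¹ : Kˣ) : K)) * Q' := by simp only [mul_assoc]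
    _ = 1 := by
      rw [mul_eq_one_comm.1 hQ, mul_one, mul_assoc Q, diagonal_mul_diagonal]
      simp [hQ]

/-- The exponentials of the nilpotent part of an element of the Lie algebra. -/
lemma exists_mem_eq_exp [CharZero K] {H : Subgroup (GL (Fin n) K)}
    (hH : IsZClosed (H : Set (GL (Fin n) K)))
    {Q Q' N : Matrix (Fin n) (Fin n) K} {d : Fin n → K}
    (hQ : Q * Q' = 1) (hN : N ^ n = 0) (hSN : Commute (Q * diagonal d * Q') N)
    (hX : Q * diagonal d * Q' + N ∈ lieOf (vanish (H : Set (GL (Fin n) K)))) (t : K) :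
    ∃ A ∈ H, (A : Matrix (Fin n) (Fin n) K) =
      ∑ k ∈ Finset.range (n + 2), (expPoly K k).eval t • N ^ k := by
  refine exists_mem_eq hH (fun p hp => ?_) (isUnit_sum_smul_pow hN (by simp [expPoly_zero]))
  have h := ev_expCurve_eq_zero_of_mem_lieOf hQ hN hSN hX (θ := MonoidHom.id (Multiplicative K))
    Function.injective_id (m := fun i => Multiplicative.ofAdd (d i)) (fun i => rfl) hp
  have h2 := spec_ev_expCurve Q Q' N (fun i => Multiplicative.ofAdd (d i)) (expPoly K)
    (Polynomial.aeval t) (1 : Multiplicative K →* K) p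
  have h3 := curve_one_left hQ N (fun k => (expPoly K k).eval t)
  rw [h, map_zero] at h2
  simp only [MonoidHom.one_apply, Polynomial.coe_aeval_eq_eval] at h2
  rw [Pi.one_def] at h3
  simp only [Algebra.algebraMap_self, RingHom.coe_id, Matrix.map_id] at h3
  rw [h2, h3]

/-- The one-parameter subgroups attached to the semisimple part of an element of the
Lie algebra. -/
lemma exists_mem_eq_zpow [CharZero K] {H : Subgroup (GL (Fin n) K)}
    (hH : IsZClosed (H : Set (GL (Fin n) K)))
    {Q Q' N : Matrix (Fin n) (Fin n) K} {d : Fin n → K}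
    (hQ : Q * Q' = 1) (hN : N ^ n = 0) (hSN : Commute (Q * diagonal d * Q') N)
    (hX : Q * diagonal d * Q' + N ∈ lieOf (vanish (H : Set (GL (Fin n) K))))
    {Λ : Submodule ℤ K} (ψ : Λ →ₗ[ℤ] ℤ) {l : Fin n → Λ} (hl : ∀ i, (l i : K) = d i) (z : Kˣ) :
    ∃ A ∈ H, (A : Matrix (Fin n) (Fin n) K) =
      Q * diagonal (fun i => ((z ^ ψ (l i) : Kˣ) : K)) * Q' := by
  refine exists_mem_eq hH (fun p hp => ?_) (isUnit_conj_diagonal hQ _)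
  have h := ev_expCurve_eq_zero_of_mem_lieOf hQ hN hSN hX
    (θ := AddMonoidHom.toMultiplicative Λ.subtype.toAddMonoidHom)
    Subtype.val_injective (m := fun i => Multiplicative.ofAdd (l i)) (fun i => hl i) hp
  have h2 := spec_ev_expCurve Q Q' N (fun i => Multiplicative.ofAdd (l i)) (expPoly K)
    (Polynomial.aeval 0) ((Units.coeHom K).comp ((zpowersHom Kˣ z).comp
      (AddMonoidHom.toMultiplicative ψ.toAddMonoidHom))) p
  rw [h, map_zero, curve_one_right _ _ _ _ (by simp [expPoly_zero])
    (fun k hk => by simpa using eval_zero_expPoly hk)] at h2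
  rw [h2]
  rfl

lemma two_zpow_injective [CharZero K] : Function.Injective fun m : ℤ => (2 : K) ^ m := by
  intro a b hab
  have h : ((2 ^ a : ℚ) : K) = ((2 ^ b : ℚ) : K) := by push_cast; exact hab
  exact zpow_right_injective₀ (by norm_num) (by norm_num) (Rat.cast_injective h)

/-- The derivative of a one-parameter subgroup. -/
lemma mem_lieOf_of_zpow [CharZero K] {H : Subgroup (GL (Fin n) K)}
    {Q Q' : Matrix (Fin n) (Fin n) K} (hQ : Q * Q' = 1) (a : Fin n → ℤ)
    (ha : ∀ z : Kˣ, ∃ A ∈ H, (A : Matrix (Fin n) (Fin n) K) =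
      Q * diagonal (fun i => ((z ^ a i : Kˣ) : K)) * Q') :
    Q * diagonal (fun i => (a i : K)) * Q' ∈ lieOf (vanish (H : Set (GL (Fin n) K))) := by
  let χ : Multiplicative ℤ →* K := (Units.coeHom K).comp
    (zpowersHom Kˣ (Units.mk0 2 two_ne_zero))
  have hχ : ∀ m : ℤ, χ (Multiplicative.ofAdd m) = 2 ^ m := fun m => by simp [χ]
  let m : Fin n → Multiplicative ℤ := fun i => Multiplicative.ofAdd (a i)
  let θ : Multiplicative ℤ →* Multiplicative K :=
    AddMonoidHom.toMultiplicative (Int.castAddHom K)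
  have h0 : ∀ p ∈ vanish (H : Set (GL (Fin n) K)),
      ev (expCurve Q Q' 0 m (expPoly K)) p = 0 := by
    intro p hp
    refine ev_expCurve_eq_zero (χ := χ) (fun x y hxy => two_zpow_injective (K := K) ?_)
      (fun x => (zpowersHom Kˣ (Units.mk0 2 two_ne_zero) x).ne_zero) fun k => ?_
    · exact (hχ x.toAdd).symm.trans (hxy.trans (hχ y.toAdd))
    · obtain ⟨A, hA, hAe⟩ := ha (Units.mk0 2 two_ne_zero ^ k)
      rw [curve_zero _ _ _ (by simp [expPoly_zero])]
      convert hp A hA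
      rw [hAe]
      congr 3
      ext i
      rw [hχ]
      push_cast
      rw [Units.val_mk0, ← zpow_natCast, ← zpow_natCast, ← _root_.zpow_mul, ← _root_.zpow_mul,
        mul_comm]
  have h1 : ((expCurve Q Q' 0 m (expPoly K)).map (toPow θ)).map (constCoeff K) = 1 := by
    rw [expCurve, map_curve, map_curve]
    simp only [toPow_single, constCoeff_apply]
    rw [curve_zero _ _ _ (by simp [expPoly_zero])]
    simp [hQ]
  have key := mem_lieOf_of_tangent (PowerSeries.derivative K) (constCoeff K)
    ((expCurve Q Q' 0 m (expPoly K)).map (toPow θ)) H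
    (fun p hp => by rw [← map_ev, h0 p hp, map_zero]) ?_
  · have hF : ((expCurve Q Q' 0 m (expPoly K)).map (toPow θ)).map (PowerSeries.derivative K) =
        (expCurve Q Q' 0 m (expPoly K)).map (toPow θ) *
          (Q * diagonal (fun i => (a i : K)) * Q' + 0).map (algebraMap K (PowerSeries K)) := by
      rw [expCurve, map_curve]
      refine map_derivation_curve _ hQ ?_ (Commute.zero_right _) (fun i => ?_) ?_ fun k => ?_
      · rcases Nat.eq_zero_or_pos n with rfl | hn
        · exact Subsingleton.elim _ _
        · exact zero_pow hn.ne'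
      · simp [toPow_single, derivative_rescale_exp, θ, m]
      · simp [toPow_single, expPoly_zero]
      · simp [toPow_single, PowerSeries.derivative_coe, derivative_expPoly_succ]
    have h2 := congrArg (constCoeff K).toRingHom.mapMatrix hF
    rw [map_mul] at h2
    replace h2 := h2.trans (congrArg₂ (· * ·) h1 rfl)
    rw [one_mul] at h2
    convert key
    refine Eq.trans ?_ h2.symm
    ext i j
    change _ = constCoeff K (algebraMap K (PowerSeries K)
      ((Q * diagonal (fun i => (a i : K)) * Q' + 0 : Matrix (Fin n) (Fin n) K) i j))
    rw [AlgHom.commutes, add_zero]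
    rfl
  · exact h1

lemma ev_curve_eq_of_pow [CharZero K] {Q Q' ν : Matrix (Fin n) (Fin n) K} {d : Fin n → Kˣ}
    {b : ℕ → Polynomial K} {A : Matrix (Fin n) (Fin n) K}
    (hA : ∀ k : ℕ, curve Q Q' ν (fun i => (d i : K) ^ k) (fun j => (b j).eval (k : K)) = A ^ k)
    {q : MvPolynomial (Fin n × Fin n) K} {D : Kˣ} {c : K}
    (hq : ∀ k : ℕ, ev (A ^ k) q = (D : K) ^ k * (k * c)) :
    ev (curve Q Q' ν 1 b) q = Polynomial.C c * Polynomial.X := by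
  have key : ev (expCurve Q Q' ν d b) q =
      MonoidAlgebra.single D (Polynomial.C c * Polynomial.X) := by
    refine toSeq_injective (χ := Units.coeHom K) Units.val_injective (fun u => u.ne_zero) ?_
    ext k
    rw [toSeq_ev_expCurve, toSeq_single]
    simp only [Units.coeHom_apply, hA, hq]
    simp only [Polynomial.eval_mul, Polynomial.eval_C, Polynomial.eval_X]
    ring
  have h := spec_ev_expCurve Q Q' ν d b (AlgHom.id K _) 1 q
  rw [key, spec_single] at h
  simpa [Pi.one_def] using h.symm

lemma ev_curve_eq_zero_of_pow [CharZero K] {Q Q' ν : Matrix (Fin n) (Fin n) K} {d : Fin n → Kˣ}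
    {b : ℕ → Polynomial K} {A : GL (Fin n) K}
    (hA : ∀ k : ℕ, curve Q Q' ν (fun i => (d i : K) ^ k) (fun j => (b j).eval (k : K)) =
      (A : Matrix (Fin n) (Fin n) K) ^ k)
    {H : Subgroup (GL (Fin n) K)} (hAH : A ∈ H)
    {p : MvPolynomial (Fin n × Fin n) K} (hp : p ∈ vanish (H : Set (GL (Fin n) K))) :
    ev (curve Q Q' ν 1 b) p = 0 := by
  rw [ev_curve_eq_of_pow hA (D := 1) (c := 0)]
  · simp
  · intro k
    rw [mul_zero, mul_zero, ← Units.val_pow_eq_pow_val]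
    exact hp _ (H.pow_mem hAH k)

/-- An additive regular function vanishes at diagonalizable elements. -/
lemma eq_zero_of_conj_diagonal [CharZero K] {Q Q' : Matrix (Fin n) (Fin n) K} {d : Fin n → Kˣ}
    (hQ : Q * Q' = 1) {A : Matrix (Fin n) (Fin n) K}
    (hA : A = Q * diagonal (fun i => (d i : K)) * Q')
    {q : MvPolynomial (Fin n × Fin n) K} {D : Kˣ} {c : K}
    (hq : ∀ k : ℕ, ev (A ^ k) q = (D : K) ^ k * (k * c)) : c = 0 := by
  have h := ev_curve_eq_of_pow (Q := Q) (Q' := Q') (ν := 0) (d := d) (b := expPoly K) (A := A)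
    (fun k => ?_) hq
  · have h1 : ∀ t : K, ev (1 : Matrix (Fin n) (Fin n) K) q = c * t := by
      intro t
      have h2 := congrArg (Polynomial.aeval t) h
      rw [map_ev, map_curve] at h2
      simp only [Pi.one_apply, map_one, Polynomial.coe_aeval_eq_eval] at h2
      rw [curve_zero _ _ _ (by simp [expPoly_zero])] at h2
      simpa [hQ] using h2
    have h2 := (h1 0).symm.trans (h1 1)
    simpa using h2.symm
  · rw [curve_zero _ _ _ (by simp [expPoly_zero]), hA]
    induction k with
    | zero => simp [hQ]
    | succ k ih =>
      rw [pow_succ, ← ih]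
      calc Q * diagonal (fun i => (d i : K) ^ (k + 1)) * Q' =
          Q * (diagonal (fun i => (d i : K) ^ k) * diagonal (fun i => (d i : K))) * Q' := by
            simp only [diagonal_mul_diagonal, pow_succ]
        _ = Q * diagonal (fun i => (d i : K) ^ k) * (Q' * Q) *
            diagonal (fun i => (d i : K)) * Q' := by
            rw [mul_eq_one_comm.1 hQ, mul_one]; simp only [mul_assoc]
        _ = _ := by simp only [mul_assoc]

lemma eval_zero_binomPoly {j : ℕ} (hj : j ≠ 0) : (binomPoly K j).eval 0 = 0 := by
  obtain ⟨j, rfl⟩ := Nat.exists_eq_succ_of_ne_zero hj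
  simp [binomPoly]

lemma binomPoly_zero : binomPoly K 0 = 1 := by simp [binomPoly]

/-- The value of an additive regular function is its derivative in some tangent direction. -/
lemma exists_mem_lieOf_ev_rder_eq [IsAlgClosed K] [CharZero K] {H : Subgroup (GL (Fin n) K)}
    {A : GL (Fin n) K} (hA : A ∈ H) {q : MvPolynomial (Fin n × Fin n) K} {D : Kˣ} {c : K}
    (hq : ∀ k : ℕ, ev ((A : Matrix (Fin n) (Fin n) K) ^ k) q = (D : K) ^ k * (k * c)) :
    ∃ X ∈ lieOf (vanish (H : Set (GL (Fin n) K))), ev 1 (rder X q) = c := by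
  obtain ⟨Q, Q', ν, d, hQ, -, hpow⟩ := exists_curve_eq_pow A
  have h1 : (curve Q Q' ν 1 (binomPoly K)).map (Polynomial.aeval (0 : K)) = 1 := by
    rw [map_curve]
    simp only [Pi.one_apply, map_one, Polynomial.coe_aeval_eq_eval]
    rw [curve_one_right _ _ _ _ (by simp [binomPoly_zero]) fun k hk => eval_zero_binomPoly hk]
    simp [hQ]
  refine ⟨_, mem_lieOf_of_tangent Polynomial.derivative' (Polynomial.aeval (0 : K))
    (curve Q Q' ν 1 (binomPoly K)) H (fun p hp => ev_curve_eq_zero_of_pow hpow hA hp) h1, ?_⟩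
  have h := map_derivation_ev Polynomial.derivative' (Polynomial.aeval (0 : K))
    (curve Q Q' ν 1 (binomPoly K)) ((curve Q Q' ν 1 (binomPoly K)).map
      fun x => Polynomial.aeval (0 : K) (Polynomial.derivative' x))
    (by rw [h1, one_mul]; ext i j; simp) q
  rw [h1, ev_curve_eq_of_pow hpow hq] at h
  rw [← h]
  simp [Polynomial.derivative']

end Consequences

end GLZariski

namespace GLZariski

variable {n : ℕ}

/-- A family of invertible matrices on which a polynomial with infinitely many zeros vanishes
identically. -/
def IsCurve {Z : Type*} (γ : Z → GL (Fin n) K) : Prop :=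
  ∀ p : MvPolynomial (Fin n × Fin n) K, {z | ev (γ z : Matrix (Fin n) (Fin n) K) p = 0}.Infinite →
    ∀ z, ev (γ z : Matrix (Fin n) (Fin n) K) p = 0

lemma IsCurve.mul_left {Z : Type*} {γ : Z → GL (Fin n) K} (hγ : IsCurve γ) (A : GL (Fin n) K) :
    IsCurve fun z => A * γ z := by
  intro p hp z
  have h (z : Z) : ev ((A * γ z : GL (Fin n) K) : Matrix (Fin n) (Fin n) K) p =
      ev (γ z : Matrix (Fin n) (Fin n) K) (ltrans (A : Matrix (Fin n) (Fin n) K) p) := by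
    rw [ev_ltrans]; rfl
  simp only [h] at hp ⊢
  exact hγ _ hp z

lemma IsCurve.forall_mem {Z : Type*} {γ : Z → GL (Fin n) K} (hγ : IsCurve γ)
    {s : Set (GL (Fin n) K)} (hs : IsZClosed s) (hi : {z | γ z ∈ s}.Infinite) (z : Z) : γ z ∈ s :=
  mem_of_isZClosed hs fun p hp => hγ p (hi.mono fun _ hz => hp _ hz) z

lemma IsCurve.forall_mem_or_forall_mem {Z : Type*} [Infinite Z] {γ : Z → GL (Fin n) K}
    (hγ : IsCurve γ) {s t : Set (GL (Fin n) K)} (hs : IsZClosed s) (ht : IsZClosed t)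
    (h : ∀ z, γ z ∈ s ∪ t) : (∀ z, γ z ∈ s) ∨ ∀ z, γ z ∈ t := by
  have huniv : ({z | γ z ∈ s} ∪ {z | γ z ∈ t}).Infinite := by
    rw [show {z | γ z ∈ s} ∪ {z | γ z ∈ t} = Set.univ from Set.eq_univ_of_forall h]
    exact Set.infinite_univ
  rcases Set.infinite_union.1 huniv with h | h
  · exact .inl (hγ.forall_mem hs h)
  · exact .inr (hγ.forall_mem ht h)

lemma isCurve_of_polynomial {γ : K → GL (Fin n) K} (F : Matrix (Fin n) (Fin n) (Polynomial K))
    (hF : ∀ t, (γ t : Matrix (Fin n) (Fin n) K) = F.map (Polynomial.aeval t)) : IsCurve γ := by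
  intro p hp z
  have h (z : K) : ev (γ z : Matrix (Fin n) (Fin n) K) p = (ev F p).eval z := by
    rw [hF, ← map_ev, Polynomial.coe_aeval_eq_eval]
  simp only [h] at hp ⊢
  rw [Polynomial.eq_zero_of_infinite_isRoot _ hp, Polynomial.eval_zero]

/-- Evaluation of Laurent polynomials at a unit. -/
noncomputable def laurentEval (z : Kˣ) : LaurentPolynomial K →ₐ[K] K where
  toRingHom := LaurentPolynomial.eval₂ (RingHom.id K) z
  commutes' a := LaurentPolynomial.eval₂_C _ _ a

lemma laurentEval_T (z : Kˣ) (m : ℤ) :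
    laurentEval z (LaurentPolynomial.T m) = ((z ^ m : Kˣ) : K) :=
  LaurentPolynomial.eval₂_T _ _ m

lemma isCurve_zpow (γ : Kˣ → GL (Fin n) K) {Q Q' : Matrix (Fin n) (Fin n) K} (a : Fin n → ℤ)
    (hγ : ∀ z, (γ z : Matrix (Fin n) (Fin n) K) =
      Q * diagonal (fun i => ((z ^ a i : Kˣ) : K)) * Q') : IsCurve γ := by
  intro p hp z
  have h (z : Kˣ) : ev (γ z : Matrix (Fin n) (Fin n) K) p =
      laurentEval z (ev (curve Q Q' 0 (fun i => LaurentPolynomial.T (a i))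
        (fun k => if k = 0 then 1 else 0)) p) := by
    rw [map_ev, map_curve, hγ, curve_zero _ _ _ (by simp)]
    simp only [laurentEval_T]
  simp only [h] at hp ⊢
  generalize ev (curve Q Q' 0 (fun i => (LaurentPolynomial.T (a i) : LaurentPolynomial K))
    (fun k => if k = 0 then 1 else 0)) p = f at hp ⊢
  obtain ⟨N, q, hq⟩ := LaurentPolynomial.exists_T_pow f
  have h' (z : Kˣ) : laurentEval z f = 0 ↔ q.eval (z : K) = 0 := by
    have := congrArg (laurentEval z) hq
    rw [map_mul, laurentEval_T] at this
    rw [show laurentEval z (Polynomial.toLaurent q) = q.eval (z : K) from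
      LaurentPolynomial.eval₂_toLaurent _ _ q] at this
    rw [this]
    simp
  simp only [h'] at hp ⊢
  have hinf : {x : K | q.IsRoot x}.Infinite :=
    (hp.image (Units.val_injective.injOn)).mono (by rintro _ ⟨z, hz, rfl⟩; exact hz)
  rw [Polynomial.eq_zero_of_infinite_isRoot _ hinf, Polynomial.eval_zero]

/-- The subgroup generated by a connected group and a commuting connected family is connected. -/
lemma isConnectedSG_range_noncommCoprod {T : Subgroup (GL (Fin n) K)} (hT : IsConnectedSG T)
    {Z : Type*} [Group Z] [Infinite Z] (γ : Z →* GL (Fin n) K) (hγ : IsCurve γ)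
    (hc : ∀ (A : T) z, Commute (T.subtype A) (γ z)) :
    IsConnectedSG (T.subtype.noncommCoprod γ hc).range := by
  intro s t hs ht hst h0
  have hmem (A) (hA : A ∈ T) (z : Z) : A * γ z ∈ (T.subtype.noncommCoprod γ hc).range :=
    ⟨(⟨A, hA⟩, z), rfl⟩
  have hT' (A) (hA : A ∈ T) : A ∈ (T.subtype.noncommCoprod γ hc).range := by
    simpa using hmem A hA 1
  have key {u v : Set (GL (Fin n) K)} (hu : IsZClosed u) (hv : IsZClosed v)
      (huv : ((T.subtype.noncommCoprod γ hc).range : Set (GL (Fin n) K)) ⊆ u ∪ v)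
      (h0 : ((T.subtype.noncommCoprod γ hc).range : Set (GL (Fin n) K)) ∩ u ∩ v = ∅)
      (hTu : (T : Set (GL (Fin n) K)) ⊆ u) :
      ((T.subtype.noncommCoprod γ hc).range : Set (GL (Fin n) K)) ⊆ u := by
    rintro _ ⟨⟨⟨A, hA⟩, z⟩, rfl⟩
    rcases (hγ.mul_left A).forall_mem_or_forall_mem hu hv (fun z => huv (hmem A hA z)) with h | h
    · exact h z
    · exfalso
      have : A ∈ ((T.subtype.noncommCoprod γ hc).range : Set (GL (Fin n) K)) ∩ u ∩ v :=
        ⟨⟨hT' A hA, hTu hA⟩, by simpa using h 1⟩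
      rw [h0] at this
      exact this
  have hsub : (T : Set (GL (Fin n) K)) ⊆ (T.subtype.noncommCoprod γ hc).range := hT'
  rcases hT s t hs ht (hsub.trans hst) (by
    rw [← Set.subset_empty_iff, ← h0]
    exact fun A hA => ⟨⟨hsub hA.1.1, hA.1.2⟩, hA.2⟩) with h | h
  · exact .inl (key hs ht hst h0 h)
  · exact .inr (key ht hs (by rwa [Set.union_comm]) (by rwa [Set.inter_right_comm]) h)

end GLZariski

namespace GLZariski

variable {n : ℕ}

lemma IsTorus.exists_conj_diagonal [IsAlgClosed K] {T : Subgroup (GL (Fin n) K)} (hT : IsTorus T) :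
    ∃ Q Q' : Matrix (Fin n) (Fin n) K, Q * Q' = 1 ∧
      ∀ A ∈ T, ∃ d, (A : Matrix (Fin n) (Fin n) K) = Q * diagonal d * Q' := by
  obtain ⟨-, -, g, hg⟩ := hT
  obtain ⟨σ, hσ⟩ : ∃ σ : K ≃+* AlgebraicClosure K, ∀ x, σ x = algebraMap K _ x :=
    ⟨RingEquiv.ofBijective (algebraMap K (AlgebraicClosure K))
      IsAlgClosed.algebraMap_bijective_of_isIntegral, fun _ => rfl⟩
  obtain ⟨g', rfl⟩ : ∃ g', glBaseChange g' = g := by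
    refine ⟨Units.map (σ.symm : AlgebraicClosure K →+* K).mapMatrix.toMonoidHom g, ?_⟩
    ext i j
    simp [glBaseChange, ← hσ]
  refine ⟨(g'⁻¹ : GL (Fin n) K), g', by simp, fun A hA => ?_⟩
  have h := hg A hA
  rw [← map_inv, ← map_mul, ← map_mul] at h
  have h' : Matrix.IsDiag ((g' * A * g'⁻¹ : GL (Fin n) K) : Matrix (Fin n) (Fin n) K) :=
    fun i j hij => (algebraMap K (AlgebraicClosure K)).injective (by
      rw [map_zero]; exact h hij)
  refine ⟨((g' * A * g'⁻¹ : GL (Fin n) K) : Matrix (Fin n) (Fin n) K).diag, ?_⟩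
  rw [h'.diagonal_diag, ← Units.val_mul, ← Units.val_mul]
  congr 1
  group

lemma isTorus_of_conj_diagonal {T : Subgroup (GL (Fin n) K)}
    (hT : IsZClosed (T : Set (GL (Fin n) K))) (hc : IsConnectedSG T)
    {Q Q' : Matrix (Fin n) (Fin n) K} (hQ : Q * Q' = 1)
    (h : ∀ A ∈ T, ∃ d, (A : Matrix (Fin n) (Fin n) K) = Q * diagonal d * Q') : IsTorus T := by
  have hQ' : Q' * Q = 1 := mul_eq_one_comm.1 hQ
  refine ⟨hT, hc, glBaseChange ⟨Q', Q, hQ', hQ⟩, fun A hA => ?_⟩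
  obtain ⟨d, hd⟩ := h A hA
  rw [← map_inv, ← map_mul, ← map_mul]
  have : ((⟨Q', Q, hQ', hQ⟩ * A * (⟨Q', Q, hQ', hQ⟩ : GL (Fin n) K)⁻¹ : GL (Fin n) K) :
      Matrix (Fin n) (Fin n) K) = diagonal d := by
    change Q' * (A : Matrix (Fin n) (Fin n) K) * Q = _
    rw [hd, Matrix.mul_assoc Q, ← Matrix.mul_assoc Q', hQ', one_mul, Matrix.mul_assoc, hQ', mul_one]
  intro i j hij
  change algebraMap K _ (_ : K) = 0
  rw [this, diagonal_apply_ne _ hij, map_zero]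

/-- The one-parameter group with weights `a` in the eigenbasis given by `Q`. -/
lemma exists_oneParameterGroup {Q Q' : Matrix (Fin n) (Fin n) K} (hQ : Q * Q' = 1)
    (a : Fin n → ℤ) : ∃ γ : Kˣ →* GL (Fin n) K, ∀ z,
      (γ z : Matrix (Fin n) (Fin n) K) = Q * diagonal (fun i => ((z ^ a i : Kˣ) : K)) * Q' := by
  have hQ' : Q' * Q = 1 := mul_eq_one_comm.1 hQ
  let γ₀ : Kˣ →* Matrix (Fin n) (Fin n) K :=
    { toFun z := Q * diagonal (fun i => ((z ^ a i : Kˣ) : K)) * Q'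
      map_one' := by simp [hQ]
      map_mul' z w := by
        rw [show Q * diagonal (fun i => ((z ^ a i : Kˣ) : K)) * Q' *
          (Q * diagonal (fun i => ((w ^ a i : Kˣ) : K)) * Q') =
          Q * diagonal (fun i => ((z ^ a i : Kˣ) : K)) * (Q' * Q) *
            diagonal (fun i => ((w ^ a i : Kˣ) : K)) * Q' by simp only [Matrix.mul_assoc], hQ',
          Matrix.mul_one, Matrix.mul_assoc Q (diagonal _) (diagonal _), diagonal_mul_diagonal]
        simp [mul_zpow] }
  exact ⟨γ₀.toHomUnits, fun z => rfl⟩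

lemma commute_conj_diagonal {Q Q' : Matrix (Fin n) (Fin n) K} (hQ : Q * Q' = 1)
    (d e : Fin n → K) : Commute (Q * diagonal d * Q') (Q * diagonal e * Q') := by
  have hQ' : Q' * Q = 1 := mul_eq_one_comm.1 hQ
  have h (d e : Fin n → K) : Q * diagonal d * Q' * (Q * diagonal e * Q') =
      Q * diagonal (fun i => d i * e i) * Q' := by
    rw [← diagonal_mul_diagonal]
    calc _ = Q * diagonal d * (Q' * Q) * diagonal e * Q' := by simp only [Matrix.mul_assoc]
      _ = _ := by rw [hQ', mul_one]; simp only [Matrix.mul_assoc]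
  rw [Commute, SemiconjBy, h, h]
  simp only [mul_comm]

/-- A one-parameter group commuting with a maximal torus is contained in it. -/
lemma mem_of_isMaximalTorus [IsAlgClosed K] [CharZero K] {G T : Subgroup (GL (Fin n) K)}
    (hG : IsZClosed (G : Set (GL (Fin n) K))) (hT : IsMaximalTorus G T)
    {Q Q' : Matrix (Fin n) (Fin n) K} (hQ : Q * Q' = 1) (a : Fin n → ℤ)
    (γ : Kˣ →* GL (Fin n) K) (hγ : ∀ z, (γ z : Matrix (Fin n) (Fin n) K) =
      Q * diagonal (fun i => ((z ^ a i : Kˣ) : K)) * Q')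
    (hγG : ∀ z, γ z ∈ G) (hγT : ∀ z, ∀ A ∈ T, Commute A (γ z)) (z : Kˣ) : γ z ∈ T := by
  obtain ⟨hT0, hTG, hmax⟩ := hT
  obtain ⟨P, P', hP, hPT⟩ := IsTorus.exists_conj_diagonal hT0
  have hcomm (A : T) (z : Kˣ) : Commute (T.subtype A) (γ z) := hγT z A A.2
  set B := (T.subtype.noncommCoprod γ hcomm).range with hB
  have hTB : T ≤ B := fun A hA => ⟨(⟨A, hA⟩, 1), by simp⟩
  have hval {A A' : GL (Fin n) K} (h : Commute A A') :
      Commute (A : Matrix (Fin n) (Fin n) K) (A' : Matrix (Fin n) (Fin n) K) :=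
        h.map (Units.coeHom _)
  obtain ⟨R, R', hR, hRd⟩ := exists_simultaneous_diagonalization
    ({M | ∃ A ∈ T, (A : Matrix (Fin n) (Fin n) K) = M} ∪
      {M | ∃ z, (γ z : Matrix (Fin n) (Fin n) K) = M}) (by
    rintro _ (⟨A, hA, rfl⟩ | ⟨z, rfl⟩)
    · obtain ⟨d, hd⟩ := hPT A hA
      rw [hd]
      exact isSemisimple_conj_diagonal hP d
    · rw [hγ]
      exact isSemisimple_conj_diagonal hQ _) (by
    rintro _ (⟨A, hA, rfl⟩ | ⟨z, rfl⟩) _ (⟨A', hA', rfl⟩ | ⟨z', rfl⟩)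
    · obtain ⟨d, hd⟩ := hPT A hA
      obtain ⟨d', hd'⟩ := hPT A' hA'
      rw [hd, hd']
      exact commute_conj_diagonal hP d d'
    · exact hval (hγT z' A hA)
    · exact (hval (hγT z A' hA')).symm
    · exact hval ((Commute.all z z').map γ))
  have hR' : R' * R = 1 := mul_eq_one_comm.1 hR
  let L : (Fin n → K) →ₗ[K] Matrix (Fin n) (Fin n) K :=
    { toFun d := R * diagonal d * R'
      map_add' d e := by rw [← Matrix.add_mul, ← Matrix.mul_add, diagonal_add]; rfl
      map_smul' c d := by
        rw [RingHom.id_apply, ← Matrix.smul_mul, ← Matrix.mul_smul, ← diagonal_smul] }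
  have hL1 : L 1 = 1 := by
    change R * diagonal 1 * R' = 1
    rw [Pi.one_def, diagonal_one, mul_one, hR]
  have hBE : (zclosure B : Set (GL (Fin n) K)) ⊆
      {A | (A : Matrix (Fin n) (Fin n) K) - 1 ∈ LinearMap.range L} := by
    refine zclosure_subset (isZClosed_sub_one_mem _) ?_
    rintro _ ⟨⟨⟨A, hA⟩, z⟩, rfl⟩
    obtain ⟨d, hd⟩ := hRd A (.inl ⟨A, hA, rfl⟩)
    obtain ⟨e, he⟩ := hRd (γ z) (.inr ⟨z, rfl⟩)
    refine ⟨(fun i => d i * e i) - 1, ?_⟩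
    rw [map_sub, hL1]
    congr 1
    change R * diagonal (fun i => d i * e i) * R' = (A : Matrix (Fin n) (Fin n) K) * γ z
    rw [hd, he, ← diagonal_mul_diagonal]
    calc _ = R * diagonal d * 1 * diagonal e * R' := by rw [mul_one]; simp only [Matrix.mul_assoc]
      _ = _ := by rw [← hR']; simp only [Matrix.mul_assoc]
  have hinf : Infinite Kˣ := by
    refine .of_injective (fun m : ℤ => Units.mk0 (2 : K) two_ne_zero ^ m) fun a b hab =>
      two_zpow_injective (K := K) ?_
    simpa using congrArg Units.val hab
  have htor : IsTorus (zclosure B) := by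
    refine isTorus_of_conj_diagonal (isZClosed_zclosure B) (isConnectedSG_zclosure
      (isConnectedSG_range_noncommCoprod hT0.2.1 γ (isCurve_zpow γ a hγ) hcomm)) hR fun A hA => ?_
    obtain ⟨d, hd⟩ := hBE hA
    refine ⟨d + 1, ?_⟩
    change _ = L (d + 1)
    rw [map_add, hd, hL1, sub_add_cancel]
  have hle : zclosure B ≤ G := zclosure_subset hG (by
    rintro _ ⟨⟨⟨A, hA⟩, z⟩, rfl⟩
    exact G.mul_mem (hTG hA) (hγG z))
  rw [← hmax _ htor hle (hTB.trans (le_zclosure B))]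
  exact le_zclosure B ⟨(1, z), by simp⟩

end GLZariski

namespace GLZariski

variable {n : ℕ}

/-- Projection of a subspace, stable under commuting endomorphisms with semisimple kernels, onto
the common kernel. -/
lemma exists_forall_apply_eq_zero {V : Type*} [AddCommGroup V] [Module K V] [FiniteDimensional K V]
    (𝒜 : Set (V →ₗ[K] V)) (hc : ∀ A ∈ 𝒜, ∀ B ∈ 𝒜, ∀ x, A (B x) = B (A x))
    (hs : ∀ A ∈ 𝒜, ∀ x, A (A x) = 0 → A x = 0) (W : Submodule K V)
    (hW : ∀ A ∈ 𝒜, ∀ x ∈ W, A x ∈ W) {x : V} (hx : x ∈ W) :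
    ∃ y ∈ W, (∀ A ∈ 𝒜, A y = 0) ∧
      ∀ ℓ : V →ₗ[K] K, (∀ A ∈ 𝒜, ∀ z ∈ W, ℓ (A z) = 0) → ℓ y = ℓ x := by
  induction h : Module.finrank K W using Nat.strong_induction_on generalizing W x with
  | _ d ih =>
    by_cases h0 : ∀ A ∈ 𝒜, ∀ z ∈ W, A z = 0
    · exact ⟨x, hx, fun A hA => h0 A hA x hx, fun ℓ _ => rfl⟩
    push Not at h0
    obtain ⟨A, hA, z, hz, hAz⟩ := h0
    have hlt : Module.finrank K (W ⊓ LinearMap.ker A : Submodule K V) < d := by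
      rw [← h]
      refine Submodule.finrank_lt_finrank_of_lt (inf_le_left.lt_of_ne fun he => hAz ?_)
      rw [← he] at hz
      exact hz.2
    obtain ⟨y, hy, hAy⟩ : ∃ y ∈ W, A (A y) = A x := by
      have hm : ∀ z ∈ W.map A, A z ∈ W.map A := by
        rintro _ ⟨z, hz, rfl⟩
        exact ⟨A z, hW A hA z hz, rfl⟩
      have hinj : Function.Injective (A.restrict hm) := by
        rw [injective_iff_map_eq_zero]
        rintro ⟨_, z, hz, rfl⟩ h
        exact Subtype.ext (hs A hA z (congrArg Subtype.val h))
      obtain ⟨⟨_, y, hy, rfl⟩, h⟩ :=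
        LinearMap.injective_iff_surjective.1 hinj ⟨A x, x, hx, rfl⟩
      exact ⟨y, hy, congrArg Subtype.val h⟩
    obtain ⟨w, hw, hw0, hwℓ⟩ := ih _ hlt (W ⊓ LinearMap.ker A)
      (fun B hB x hx => ⟨hW B hB x hx.1, LinearMap.mem_ker.2 <| by
        rw [hc A hA B hB, LinearMap.mem_ker.1 hx.2, map_zero]⟩)
      (x := x - A y) ⟨W.sub_mem hx (hW A hA y hy), LinearMap.mem_ker.2 <| by
        rw [map_sub, hAy, sub_self]⟩ rfl
    refine ⟨w, hw.1, hw0, fun ℓ hℓ => ?_⟩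
    rw [hwℓ ℓ fun B hB z hz => hℓ B hB z hz.1, map_sub, hℓ A hA y hy, sub_zero]

/-- The difference of conjugation by a matrix and the identity. -/
def conjSub (A : GL (Fin n) K) : Matrix (Fin n) (Fin n) K →ₗ[K] Matrix (Fin n) (Fin n) K :=
  (LinearMap.mulRight K ((A⁻¹ : GL (Fin n) K) : Matrix (Fin n) (Fin n) K)).comp
    (LinearMap.mulLeft K (A : Matrix (Fin n) (Fin n) K)) - LinearMap.id

lemma conjSub_apply (A : GL (Fin n) K) (X : Matrix (Fin n) (Fin n) K) :
    conjSub A X = A * X * ((A⁻¹ : GL (Fin n) K) : Matrix (Fin n) (Fin n) K) - X := rfl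

lemma conjSub_eq_zero {A : GL (Fin n) K} {X : Matrix (Fin n) (Fin n) K} :
    conjSub A X = 0 ↔ Commute (A : Matrix (Fin n) (Fin n) K) X := by
  rw [conjSub_apply, sub_eq_zero, Units.mul_inv_eq_iff_eq_mul]
  rfl

/-- The projection of a subspace stable under conjugation by a diagonalizable group onto the
centralizer of this group. -/
lemma exists_commute_of_conj_diagonal {T : Subgroup (GL (Fin n) K)}
    {Q Q' : Matrix (Fin n) (Fin n) K} (hQ : Q * Q' = 1)
    (hT : ∀ A ∈ T, ∃ d, (A : Matrix (Fin n) (Fin n) K) = Q * diagonal d * Q')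
    (W : Submodule K (Matrix (Fin n) (Fin n) K))
    (hW : ∀ A ∈ T, ∀ X ∈ W, (A : Matrix (Fin n) (Fin n) K) * X *
      ((A⁻¹ : GL (Fin n) K) : Matrix (Fin n) (Fin n) K) ∈ W)
    {X : Matrix (Fin n) (Fin n) K} (hX : X ∈ W) :
    ∃ Y ∈ W, (∀ A ∈ T, Commute (A : Matrix (Fin n) (Fin n) K) Y) ∧
      ∀ ℓ : Matrix (Fin n) (Fin n) K →ₗ[K] K, (∀ A ∈ T, ∀ Z ∈ W,
        ℓ ((A : Matrix (Fin n) (Fin n) K) * Z *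
          ((A⁻¹ : GL (Fin n) K) : Matrix (Fin n) (Fin n) K)) = ℓ Z) → ℓ Y = ℓ X := by
  have hQ' : Q' * Q = 1 := mul_eq_one_comm.1 hQ
  have hform (A : GL (Fin n) K) (hA : A ∈ T) : ∃ c : Fin n → Fin n → K, ∀ X i j,
      (Q' * conjSub A X * Q) i j = c i j * (Q' * X * Q) i j := by
    obtain ⟨d, hd⟩ := hT A hA
    obtain ⟨e, he⟩ := hT A⁻¹ (T.inv_mem hA)
    refine ⟨fun i j => d i * e j - 1, fun X i j => ?_⟩
    have : Q' * conjSub A X * Q = diagonal d * (Q' * X * Q) * diagonal e - Q' * X * Q := by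
      rw [conjSub_apply, hd, he, Matrix.mul_sub, Matrix.sub_mul]
      congr 1
      calc _ = (Q' * Q) * diagonal d * (Q' * X * Q) * diagonal e * (Q' * Q) := by
            simp only [Matrix.mul_assoc]
        _ = _ := by rw [hQ', one_mul, mul_one]
    rw [this, Matrix.sub_apply, mul_diagonal, diagonal_mul]
    ring
  have hext {X Y : Matrix (Fin n) (Fin n) K} (h : ∀ i j, (Q' * X * Q) i j = (Q' * Y * Q) i j) :
      X = Y := by
    have h' : Q' * X * Q = Q' * Y * Q := by ext i j; exact h i j
    have hr (X : Matrix (Fin n) (Fin n) K) : Q * (Q' * X * Q) * Q' = X := by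
      calc _ = (Q * Q') * X * (Q * Q') := by simp only [Matrix.mul_assoc]
        _ = X := by rw [hQ, one_mul, mul_one]
    rw [← hr X, h', hr]
  obtain ⟨Y, hY, hY0, hYℓ⟩ := exists_forall_apply_eq_zero (conjSub '' (T : Set (GL (Fin n) K)))
    (by
      rintro _ ⟨A, hA, rfl⟩ _ ⟨B, hB, rfl⟩ X
      obtain ⟨c, hc⟩ := hform A hA
      obtain ⟨c', hc'⟩ := hform B hB
      refine hext fun i j => ?_
      rw [hc, hc', hc', hc]
      ring) (by
      rintro _ ⟨A, hA, rfl⟩ X h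
      obtain ⟨c, hc⟩ := hform A hA
      refine hext fun i j => ?_
      have h' := hc (conjSub A X) i j
      rw [h, hc] at h'
      rw [hc]
      simp only [mul_zero, zero_mul, Matrix.zero_apply] at h' ⊢
      have h'' := mul_eq_zero.1 h'.symm
      rcases h'' with h'' | h''
      · rw [h'', zero_mul]
      · exact h'') W (by
      rintro _ ⟨A, hA, rfl⟩ X hX
      exact W.sub_mem (hW A hA X hX) hX) hX
  refine ⟨Y, hY, fun A hA => conjSub_eq_zero.1 (hY0 _ ⟨A, hA, rfl⟩), fun ℓ hℓ => hYℓ ℓ ?_⟩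
  rintro _ ⟨A, hA, rfl⟩ Z hZ
  rw [conjSub_apply, map_sub, hℓ A hA Z hZ, sub_self]

end GLZariski

namespace GLZariski

attribute [local instance] LieRing.ofAssociativeRing

variable {n : ℕ}

lemma conj_diagonal_mem_of_forall_dual [CharZero K] {Q Q' : Matrix (Fin n) (Fin n) K}
    {d : Fin n → K} (P : Submodule K (Matrix (Fin n) (Fin n) K))
    {l : Fin n → Submodule.span ℤ (Set.range d)} (hl : ∀ i, (l i : K) = d i)
    (h : ∀ ψ : Submodule.span ℤ (Set.range d) →ₗ[ℤ] ℤ,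
      Q * diagonal (fun i => (ψ (l i) : K)) * Q' ∈ P) : Q * diagonal d * Q' ∈ P := by
  have : Module.Finite ℤ (Submodule.span ℤ (Set.range d)) :=
    Module.Finite.span_of_finite ℤ (Set.finite_range d)
  let b := Module.Free.chooseBasis ℤ (Submodule.span ℤ (Set.range d))
  have hd : Q * diagonal d * Q' =
      ∑ j, (b j : K) • (Q * diagonal (fun i => (b.coord j (l i) : K)) * Q') := by
    have : diagonal d = ∑ j, (b j : K) • diagonal (fun i => (b.coord j (l i) : K)) := by
      ext i k
      rw [Matrix.sum_apply]
      by_cases hik : i = k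
      · subst hik
        have h' := congrArg (Submodule.subtype _) (b.sum_repr (l i))
        simp only [map_sum, map_zsmul, Submodule.subtype_apply, hl] at h'
        simp [← h', mul_comm]
      · simp [diagonal_apply_ne _ hik]
    rw [this, Matrix.mul_sum, Matrix.sum_mul]
    simp
  rw [hd]
  exact P.sum_mem fun j _ => P.smul_mem _ (h _)

lemma mem_lieOf_semisimple_part [IsAlgClosed K] [CharZero K] {H : Subgroup (GL (Fin n) K)}
    (hH : IsZClosed (H : Set (GL (Fin n) K)))
    {Q Q' N : Matrix (Fin n) (Fin n) K} {d : Fin n → K} (hQ : Q * Q' = 1) (hN : N ^ n = 0)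
    (hSN : Commute (Q * diagonal d * Q') N)
    (hX : Q * diagonal d * Q' + N ∈ lieOf (vanish (H : Set (GL (Fin n) K)))) :
    Q * diagonal d * Q' ∈ lieOf (vanish (H : Set (GL (Fin n) K))) :=
  conj_diagonal_mem_of_forall_dual (lieOf (vanish (H : Set (GL (Fin n) K)))).toSubmodule
    (l := fun i => ⟨d i, Submodule.subset_span ⟨i, rfl⟩⟩) (fun _ => rfl) fun ψ =>
    mem_lieOf_of_zpow hQ _ fun z => exists_mem_eq_zpow hH hQ hN hSN hX ψ (fun _ => rfl) z

end GLZariski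

namespace GLZariski

attribute [local instance] LieRing.ofAssociativeRing

variable {n : ℕ}

lemma isConnectedSG_of_isUnipotentElt [CharZero K] {R : Subgroup (GL (Fin n) K)}
    (hR : IsZClosed (R : Set (GL (Fin n) K))) (hu : ∀ u ∈ R, IsUnipotentElt u) :
    IsConnectedSG R := by
  have hcurve (u) (h : u ∈ R) : ∃ γ : K → GL (Fin n) K, IsCurve γ ∧ (∀ t, γ t ∈ R) ∧
      γ 0 = 1 ∧ γ 1 = u := by
    set ν : Matrix (Fin n) (Fin n) K := (u : Matrix (Fin n) (Fin n) K) - 1 with hν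
    have hνn : ν ^ n = 0 := hu u h
    have hunit (t : K) : IsUnit (∑ j ∈ Finset.range (n + 2), (binomPoly K j).eval t • ν ^ j) :=
      isUnit_sum_smul_pow hνn (by simp [binomPoly_zero])
    have hpow (k : ℕ) : (hunit (k : K)).unit = u ^ k := by
      ext1
      rw [IsUnit.unit_spec, sum_binomPoly_smul_pow hνn, hν, add_sub_cancel,
        Units.val_pow_eq_pow_val]
    have hγ : IsCurve fun t => (hunit t).unit := by
      refine isCurve_of_polynomial (∑ j ∈ Finset.range (n + 2),
        binomPoly K j • (ν ^ j).map (algebraMap K (Polynomial K))) fun t => ?_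
      rw [IsUnit.unit_spec]
      ext i j
      simp [Matrix.sum_apply, Polynomial.coe_aeval_eq_eval, Polynomial.eval_finsetSum]
    refine ⟨_, hγ, hγ.forall_mem hR ?_, ?_, ?_⟩
    · refine (Set.infinite_range_of_injective (Nat.cast_injective (R := K))).mono ?_
      rintro _ ⟨k, rfl⟩
      rw [Set.mem_ofPred_eq, hpow]
      exact R.pow_mem h k
    · simpa using hpow 0
    · simpa using hpow 1
  have : Infinite K := CharZero.infinite K
  have key {s t : Set (GL (Fin n) K)} (hs : IsZClosed s) (ht : IsZClosed t)
      (hst : (R : Set (GL (Fin n) K)) ⊆ s ∪ t) (h0 : (R : Set (GL (Fin n) K)) ∩ s ∩ t = ∅)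
      (h1 : 1 ∈ s) : (R : Set (GL (Fin n) K)) ⊆ s := by
    intro u hu
    obtain ⟨γ, hγ, hγR, hγ0, hγ1⟩ := hcurve u hu
    rcases hγ.forall_mem_or_forall_mem hs ht (fun z => hst (hγR z)) with h | h
    · exact hγ1 ▸ h 1
    · have : (1 : GL (Fin n) K) ∈ (R : Set (GL (Fin n) K)) ∩ s ∩ t :=
        ⟨⟨R.one_mem, h1⟩, hγ0 ▸ h 0⟩
      rw [h0] at this
      exact this.elim
  intro s t hs ht hst h0
  rcases hst R.one_mem with h | h
  · exact .inl (key hs ht hst h0 h)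
  · exact .inr (key ht hs (by rwa [Set.union_comm]) (by rwa [Set.inter_right_comm]) h)

/-- Elements of the radical of the trace form on the Lie algebra of a closed group are
nilpotent. -/
lemma pow_eq_zero_of_trace_mul_eq_zero [IsAlgClosed K] [CharZero K] {G : Subgroup (GL (Fin n) K)}
    (hG : IsZClosed (G : Set (GL (Fin n) K))) {X : Matrix (Fin n) (Fin n) K}
    (hX : X ∈ lieOf (vanish (G : Set (GL (Fin n) K))))
    (h : ∀ Y ∈ lieOf (vanish (G : Set (GL (Fin n) K))), (X * Y).trace = 0) : X ^ n = 0 := by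
  obtain ⟨Q, Q', d, N, hQ, rfl, hN, hS, hNc⟩ := exists_jordan_decomposition X
  have hQ' := mul_eq_one_comm.1 hQ
  have hSN : Commute (Q * diagonal d * Q') N := (hS N (hNc _ (Commute.refl _)).symm).symm
  let l : Fin n → Submodule.span ℤ (Set.range d) := fun i => ⟨d i, Submodule.subset_span ⟨i, rfl⟩⟩
  have hl0 : l = 0 := by
    have : Module.Finite ℤ (Submodule.span ℤ (Set.range d)) :=
      Module.Finite.span_of_finite ℤ (Set.finite_range d)
    ext1 i
    refine (Module.forall_dual_apply_eq_zero_iff ℤ (l i)).1 fun ψ => ?_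
    have hψ := h _ (mem_lieOf_of_zpow hQ _
      fun z => exists_mem_eq_zpow hG hQ hN hSN hX ψ (l := l) (fun _ => rfl) z)
    have hc : Commute N (Q * diagonal (fun i => (ψ (l i) : K)) * Q') := by
      refine commute_conj_diagonal_comp hQ (fun i j hij => ?_) hSN.symm
      rw [show l i = l j from Subtype.ext hij]
    have hnil : (N * (Q * diagonal (fun i => (ψ (l i) : K)) * Q')).trace = 0 :=
      (Matrix.isNilpotent_trace_of_isNilpotent (hc.isNilpotent_mul_right ⟨n, hN⟩)).eq_zero
    rw [Matrix.add_mul, Matrix.trace_add, hnil, add_zero] at hψ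
    have hsum : ∑ i, d i * (ψ (l i) : K) = 0 := by
      rw [← hψ, show Q * diagonal d * Q' * (Q * diagonal (fun i => (ψ (l i) : K)) * Q') =
        Q * (diagonal d * (Q' * Q) * diagonal (fun i => (ψ (l i) : K)) * Q') by
          simp only [Matrix.mul_assoc], hQ', mul_one, Matrix.trace_mul_comm, diagonal_mul_diagonal,
        Matrix.mul_assoc, hQ', mul_one, trace_diagonal]
    have hsum' : ∑ i, ψ (l i) • l i = 0 := by
      refine Subtype.ext ?_
      simp only [AddSubmonoidClass.coe_finsetSum, SetLike.val_smul, ZeroMemClass.coe_zero, l,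
        zsmul_eq_mul]
      rw [← hsum]
      exact Finset.sum_congr rfl fun i _ => mul_comm _ _
    have hsq := congrArg ψ hsum'
    simp only [map_sum, map_smul, smul_eq_mul, map_zero] at hsq
    exact mul_self_eq_zero.1
      ((Finset.sum_eq_zero_iff_of_nonneg fun i _ => mul_self_nonneg _).1 hsq i (Finset.mem_univ i))
  have hd : d = 0 := funext fun i => congrArg Subtype.val (congrFun hl0 i)
  have : diagonal (0 : Fin n → K) = 0 := diagonal_zero
  rw [hd, this, mul_zero, zero_mul, zero_add, hN]

end GLZariski

namespace GLZariski

attribute [local instance] LieRing.ofAssociativeRing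

variable {n : ℕ}

/-- The radical of the trace form of a Lie algebra of matrices. -/
def traceRadical (L : LieSubalgebra K (Matrix (Fin n) (Fin n) K)) :
    LieSubalgebra K (Matrix (Fin n) (Fin n) K) where
  carrier := {X | X ∈ L ∧ ∀ Y ∈ L, (X * Y).trace = 0}
  add_mem' {X X'} hX hX' := ⟨L.add_mem hX.1 hX'.1, fun Y hY => by
    rw [Matrix.add_mul, trace_add, hX.2 Y hY, hX'.2 Y hY, add_zero]⟩
  zero_mem' := ⟨L.zero_mem, fun Y _ => by rw [Matrix.zero_mul, trace_zero]⟩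
  smul_mem' c X hX := ⟨L.smul_mem c hX.1, fun Y hY => by
    rw [Matrix.smul_mul, trace_smul, hX.2 Y hY, smul_zero]⟩
  lie_mem' {X X'} hX hX' := ⟨L.lie_mem hX.1 hX'.1, fun Y hY => by
    have h := hX.2 _ (L.lie_mem hX'.1 hY)
    rw [Ring.lie_def, Matrix.mul_sub, trace_sub] at h
    rw [Ring.lie_def, Matrix.sub_mul, trace_sub, Matrix.mul_assoc, Matrix.mul_assoc X',
      trace_mul_comm X', Matrix.mul_assoc, h]⟩

lemma conj_mem_traceRadical (G : Subgroup (GL (Fin n) K)) {A : GL (Fin n) K} (hA : A ∈ G)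
    {X : Matrix (Fin n) (Fin n) K}
    (hX : X ∈ traceRadical (lieOf (vanish (G : Set (GL (Fin n) K))))) :
    (A : Matrix (Fin n) (Fin n) K) * X * ((A⁻¹ : GL (Fin n) K) : Matrix (Fin n) (Fin n) K) ∈
      traceRadical (lieOf (vanish (G : Set (GL (Fin n) K)))) := by
  refine ⟨conj_mem_lieOf G hA hX.1, fun Y hY => ?_⟩
  have h := hX.2 _ (conj_mem_lieOf G (G.inv_mem hA) hY)
  rw [inv_inv] at h
  rw [← h, Matrix.mul_assoc, Matrix.mul_assoc, trace_mul_comm]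
  simp only [Matrix.mul_assoc]

/-- The trace form on the Lie algebra of a reductive group is nondegenerate. -/
lemma traceRadical_eq_bot [IsAlgClosed K] [CharZero K] {G : Subgroup (GL (Fin n) K)}
    (hG : IsReductive G) {X : Matrix (Fin n) (Fin n) K}
    (hX : X ∈ traceRadical (lieOf (vanish (G : Set (GL (Fin n) K))))) : X = 0 := by
  obtain ⟨hGcl, -, hGred⟩ := hG
  set r := traceRadical (lieOf (vanish (G : Set (GL (Fin n) K)))) with hr
  have hnil : LieModule.IsNilpotent r (Fin n → K) := by
    rw [LieModule.isNilpotent_iff_forall' (R := K)]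
    rintro ⟨Y, hY⟩
    have hYn := pow_eq_zero_of_trace_mul_eq_zero hGcl hY.1 hY.2
    refine ⟨n, ?_⟩
    change (toLin' Y) ^ n = 0
    rw [← toLin'_pow, hYn, map_zero]
  obtain ⟨m, hm⟩ := LieModule.IsNilpotent.nilpotent K r (Fin n → K)
  let V (k : ℕ) : Submodule K (Fin n → K) := (LieModule.lowerCentralSeries K r (Fin n → K) k)
  have hV0 : V 0 = ⊤ := rfl
  have hVm : V m = ⊥ := by simp [V, hm]
  have hanti (k : ℕ) : V (k + 1) ≤ V k :=
    LieModule.antitone_lowerCentralSeries K r (Fin n → K) k.le_succ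
  have hspan (k : ℕ) : V (k + 1) = Submodule.span K {w | ∃ Y ∈ r, ∃ v ∈ V k, Y *ᵥ v = w} := by
    simp only [V]
    rw [LieModule.lowerCentralSeries_succ, LieSubmodule.lieIdeal_oper_eq_linear_span']
    congr 1
    ext w
    constructor
    · rintro ⟨Y, -, v, hv, rfl⟩
      exact ⟨Y, Y.2, v, hv, rfl⟩
    · rintro ⟨Y, hY, v, hv, rfl⟩
      exact ⟨⟨Y, hY⟩, trivial, v, hv, rfl⟩
  have hrV (k : ℕ) (Y) (hY : Y ∈ r) (v) (hv : v ∈ V k) : Y *ᵥ v ∈ V (k + 1) := by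
    rw [hspan]
    exact Submodule.subset_span ⟨Y, hY, v, hv, rfl⟩
  have hGV (A) (hA : A ∈ G) (k : ℕ) : ∀ v ∈ V k, (A : Matrix (Fin n) (Fin n) K) *ᵥ v ∈ V k := by
    induction k with
    | zero => intro v _; exact trivial
    | succ k ih =>
      intro v hv
      rw [hspan] at hv
      induction hv using Submodule.span_induction with
      | mem w hw =>
        obtain ⟨Y, hY, v, hv, rfl⟩ := hw
        have := hrV k _ (conj_mem_traceRadical G hA hY) _ (ih v hv)
        rw [mulVec_mulVec, Units.inv_mul_cancel_right, ← mulVec_mulVec] at this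
        exact this
      | zero => rw [mulVec_zero]; exact (V (k + 1)).zero_mem
      | add v w _ _ hv hw => rw [mulVec_add]; exact (V (k + 1)).add_mem hv hw
      | smul c v _ hv => rw [mulVec_smul]; exact (V (k + 1)).smul_mem c hv
  let E : Submodule K (Matrix (Fin n) (Fin n) K) :=
    { carrier := {Y | ∀ k, ∀ v ∈ V k, Y *ᵥ v ∈ V (k + 1)}
      add_mem' hY hZ k v hv := by
        rw [add_mulVec]; exact (V (k + 1)).add_mem (hY k v hv) (hZ k v hv)
      zero_mem' k v _ := by rw [zero_mulVec]; exact (V (k + 1)).zero_mem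
      smul_mem' c Y hY k v hv := by
        rw [smul_mulVec]; exact (V (k + 1)).smul_mem c (hY k v hv) }
  have hrE (Y) (hY : Y ∈ r) : Y ∈ E := fun k v hv => hrV k Y hY v hv
  have hEmul (Y) (hY : Y ∈ E) (Z) (hZ : Z ∈ E) : Y * Z ∈ E := fun k v hv => by
    rw [← mulVec_mulVec]
    exact hY k _ (hanti k (hZ k v hv))
  have hEnil (Y) (hY : Y ∈ E) : Y ^ n = 0 := by
    refine pow_eq_zero_of_isNilpotent ⟨m, ?_⟩
    have (k : ℕ) (v : Fin n → K) : (Y ^ k) *ᵥ v ∈ V k := by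
      induction k with
      | zero => exact trivial
      | succ k ih => rw [pow_succ', ← mulVec_mulVec]; exact hY k _ ih
    refine ext_of_mulVec_single fun i => ?_
    have h := this m (Pi.single i 1)
    rw [hVm, Submodule.mem_bot] at h
    rw [h, zero_mulVec]
  have hEG (A) (hA : A ∈ G) (Y) (hY : Y ∈ E) : (A : Matrix (Fin n) (Fin n) K) * Y *
      ((A⁻¹ : GL (Fin n) K) : Matrix (Fin n) (Fin n) K) ∈ E := fun k v hv => by
    rw [← mulVec_mulVec, ← mulVec_mulVec]
    exact hGV A hA _ _ (hY k _ (hGV _ (G.inv_mem hA) k v hv))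
  let R : Subgroup (GL (Fin n) K) :=
    { carrier := {u | u ∈ G ∧ (u : Matrix (Fin n) (Fin n) K) - 1 ∈ E}
      mul_mem' {u w} hu hw := ⟨G.mul_mem hu.1 hw.1, by
        have : ((u * w : GL (Fin n) K) : Matrix (Fin n) (Fin n) K) - 1 =
            ((u : Matrix (Fin n) (Fin n) K) - 1) * ((w : Matrix (Fin n) (Fin n) K) - 1) +
              ((u : Matrix (Fin n) (Fin n) K) - 1) + ((w : Matrix (Fin n) (Fin n) K) - 1) := by
          rw [Units.val_mul]; noncomm_ring
        rw [this]
        exact E.add_mem (E.add_mem (hEmul _ hu.2 _ hw.2) hu.2) hw.2⟩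
      one_mem' := ⟨G.one_mem, by rw [Units.val_one, sub_self]; exact E.zero_mem⟩
      inv_mem' {u} hu := ⟨G.inv_mem hu.1, fun k v hv => by
        have : ((u⁻¹ : GL (Fin n) K) : Matrix (Fin n) (Fin n) K) - 1 =
            -(((u⁻¹ : GL (Fin n) K) : Matrix (Fin n) (Fin n) K) *
              ((u : Matrix (Fin n) (Fin n) K) - 1)) := by
          rw [mul_sub, Units.inv_mul, mul_one, neg_sub]
        rw [this, neg_mulVec, ← mulVec_mulVec]
        exact (V (k + 1)).neg_mem (hGV _ (G.inv_mem hu.1) _ _ (hu.2 k v hv))⟩ }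
  have hRcl : IsZClosed (R : Set (GL (Fin n) K)) := IsZClosed.inter hGcl (isZClosed_sub_one_mem E)
  have hRu (u) (hu : u ∈ R) : IsUnipotentElt u := hEnil _ hu.2
  have hRbot : R = ⊥ := by
    refine hGred R (fun u hu => hu.1) hRcl (isConnectedSG_of_isUnipotentElt hRcl hRu)
      (fun g hg u hu => ⟨G.mul_mem (G.mul_mem hg hu.1) (G.inv_mem hg), ?_⟩) hRu
    have := hEG g hg _ hu.2
    rwa [mul_sub, mul_one, sub_mul, Units.mul_inv] at this
  have hXn : X ^ n = 0 := hEnil X (hrE X hX)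
  obtain ⟨A, hA, hAX⟩ := exists_mem_eq_exp hGcl (Q := 1) (Q' := 1) (d := 0) (N := X) (one_mul 1) hXn
    (by simp) (by simpa using hX.1) 1
  rw [Finset.sum_range_succ', expPoly_zero, Polynomial.eval_one, pow_zero, one_smul] at hAX
  have hA1 : (A : Matrix (Fin n) (Fin n) K) - 1 =
      X * ∑ k ∈ Finset.range (n + 1), (expPoly K (k + 1)).eval 1 • X ^ k := by
    rw [hAX, add_sub_cancel_right, Finset.mul_sum]
    exact Finset.sum_congr rfl fun k _ => by rw [mul_smul_comm, pow_succ']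
  have hpowE (k : ℕ) : X ^ (k + 1) ∈ E := by
    induction k with
    | zero => rw [zero_add, pow_one]; exact hrE X hX
    | succ k ih => rw [pow_succ]; exact hEmul _ ih _ (hrE X hX)
  have hAR : A ∈ R := by
    refine ⟨hA, ?_⟩
    rw [hAX, add_sub_cancel_right]
    exact E.sum_mem fun k _ => E.smul_mem _ (hpowE k)
  rw [hRbot, Subgroup.mem_bot] at hAR
  rw [hAR, Units.val_one, sub_self] at hA1
  have hunit := isUnit_sum_smul_pow hXn (c := fun k => (expPoly K (k + 1)).eval 1)
    (by simp [expPoly])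
  rw [Finset.sum_range_succ, pow_eq_zero_of_le (Nat.le_succ n) hXn, smul_zero, add_zero] at hunit
  exact hunit.mul_left_eq_zero.1 hA1.symm

end GLZariski

namespace GLZariski

attribute [local instance] LieRing.ofAssociativeRing

variable {n : ℕ}

/-- Semisimple parts of elements of the Lie algebra centralizing a maximal torus commute with the
centralizer of this torus. -/
lemma commute_semisimple_part [IsAlgClosed K] [CharZero K] {G T : Subgroup (GL (Fin n) K)}
    (hG : IsZClosed (G : Set (GL (Fin n) K))) (hT : IsMaximalTorus G T)
    {Q Q' N : Matrix (Fin n) (Fin n) K} {d : Fin n → K} (hQ : Q * Q' = 1) (hN : N ^ n = 0)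
    (hSN : Commute (Q * diagonal d * Q') N)
    (hX : Q * diagonal d * Q' + N ∈ lieOf (vanish (G : Set (GL (Fin n) K))))
    (hST : ∀ A ∈ T, Commute (A : Matrix (Fin n) (Fin n) K) (Q * diagonal d * Q'))
    {Z : Matrix (Fin n) (Fin n) K} (hZ : ∀ A ∈ T, Commute (A : Matrix (Fin n) (Fin n) K) Z) :
    Commute Z (Q * diagonal d * Q') := by
  let l : Fin n → Submodule.span ℤ (Set.range d) := fun i => ⟨d i, Submodule.subset_span ⟨i, rfl⟩⟩
  have : Module.Finite ℤ (Submodule.span ℤ (Set.range d)) :=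
    Module.Finite.span_of_finite ℤ (Set.finite_range d)
  rw [commute_conj_diagonal_iff hQ]
  intro i j
  by_cases h0 : (Q' * Z * Q) i j = 0
  · simp [h0]
  have hl : l i - l j = 0 := by
    refine (Module.forall_dual_apply_eq_zero_iff ℤ _).1 fun ψ => ?_
    obtain ⟨γ, hγ⟩ := exists_oneParameterGroup hQ fun i => ψ (l i)
    have hγT := mem_of_isMaximalTorus hG hT hQ _ γ hγ (fun z => by
      obtain ⟨A, hA, hAz⟩ := exists_mem_eq_zpow hG hQ hN hSN hX ψ (l := l) (fun _ => rfl) z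
      rwa [show γ z = A from Units.ext ((hγ z).trans hAz.symm)]) (fun z A hA => by
      have := commute_conj_diagonal_comp hQ (e := fun i => ((z ^ ψ (l i) : Kˣ) : K))
        (fun i j hij => by rw [show l i = l j from Subtype.ext hij]) (hST A hA)
      rw [← hγ] at this
      exact Units.ext this) (Units.mk0 2 two_ne_zero)
    have h := (hZ _ hγT).symm
    rw [hγ, commute_conj_diagonal_iff hQ] at h
    have h' := h i j
    rw [mul_comm] at h'
    have h2 := mul_right_cancel₀ h0 h'
    rw [map_sub, sub_eq_zero]
    refine (two_zpow_injective (K := K) ?_).symm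
    simpa using h2
  rw [mul_comm, show d i = d j from congrArg Subtype.val (sub_eq_zero.1 hl)]

/-- The centralizer of a set of matrices in a Lie algebra of matrices. -/
def lieCentralizer (L : LieSubalgebra K (Matrix (Fin n) (Fin n) K)) (T : Subgroup (GL (Fin n) K)) :
    LieSubalgebra K (Matrix (Fin n) (Fin n) K) where
  carrier := {X | X ∈ L ∧ ∀ A ∈ T, Commute (A : Matrix (Fin n) (Fin n) K) X}
  add_mem' hX hY := ⟨L.add_mem hX.1 hY.1, fun A hA => (hX.2 A hA).add_right (hY.2 A hA)⟩
  zero_mem' := ⟨L.zero_mem, fun _ _ => Commute.zero_right _⟩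
  smul_mem' c _ hX := ⟨L.smul_mem c hX.1, fun A hA => (hX.2 A hA).smul_right c⟩
  lie_mem' {X Y} hX hY := ⟨L.lie_mem hX.1 hY.1, fun A hA => by
    rw [Ring.lie_def]
    exact ((hX.2 A hA).mul_right (hY.2 A hA)).sub_right ((hY.2 A hA).mul_right (hX.2 A hA))⟩

/-- The centralizer of a maximal torus is nilpotent. -/
lemma isNilpotent_lieCentralizer [IsAlgClosed K] [CharZero K] {G T : Subgroup (GL (Fin n) K)}
    (hG : IsZClosed (G : Set (GL (Fin n) K))) (hT : IsMaximalTorus G T) :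
    LieRing.IsNilpotent (lieCentralizer (lieOf (vanish (G : Set (GL (Fin n) K)))) T) := by
  set c := lieCentralizer (lieOf (vanish (G : Set (GL (Fin n) K)))) T
  rw [LieAlgebra.isNilpotent_iff_forall (R := K)]
  rintro ⟨Y, hY⟩
  obtain ⟨Q, Q', d, N, hQ, hYN, hN, hS, hNc⟩ := exists_jordan_decomposition Y
  have hSN : Commute (Q * diagonal d * Q') N := (hS N (hNc _ (Commute.refl _)).symm).symm
  obtain ⟨m, hm⟩ := LieAlgebra.ad_nilpotent_of_nilpotent (R := K) (a := N) ⟨n, hN⟩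
  refine ⟨m, LinearMap.ext fun Z => Subtype.ext ?_⟩
  have key (k : ℕ) : (((LieAlgebra.ad K c ⟨Y, hY⟩) ^ k) Z : Matrix (Fin n) (Fin n) K) =
      ((LieAlgebra.ad K (Matrix (Fin n) (Fin n) K) N) ^ k) Z := by
    induction k with
    | zero => rfl
    | succ k ih =>
      rw [pow_succ', pow_succ', Module.End.mul_apply, Module.End.mul_apply, ← ih,
        LieAlgebra.ad_apply, LieAlgebra.ad_apply, LieSubalgebra.coe_bracket]
      generalize ((LieAlgebra.ad K c ⟨Y, hY⟩) ^ k) Z = W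
      have hc := commute_semisimple_part hG hT hQ hN hSN (hYN ▸ hY.1)
        (fun A hA => hS _ (hY.2 A hA)) W.2.2
      change ⁅Y, (W : Matrix (Fin n) (Fin n) K)⁆ = _
      rw [hYN, add_lie, Ring.lie_def, hc.eq, sub_self, zero_add]
  rw [key, hm]
  rfl

/-- In the Lie algebra of a reductive group, elements centralizing a maximal torus are
semisimple. -/
lemma nilpotent_part_eq_zero [IsAlgClosed K] [CharZero K] {G T : Subgroup (GL (Fin n) K)}
    (hG : IsReductive G) (hT : IsMaximalTorus G T)
    {Q Q' N : Matrix (Fin n) (Fin n) K} {d : Fin n → K} (hQ : Q * Q' = 1) (hN : N ^ n = 0)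
    (hSN : Commute (Q * diagonal d * Q') N)
    (hX : Q * diagonal d * Q' + N ∈ lieOf (vanish (G : Set (GL (Fin n) K))))
    (hNT : ∀ A ∈ T, Commute (A : Matrix (Fin n) (Fin n) K) N) : N = 0 := by
  have hNG : N ∈ lieOf (vanish (G : Set (GL (Fin n) K))) := by
    have := sub_mem hX (mem_lieOf_semisimple_part hG.1 hQ hN hSN hX)
    rwa [add_sub_cancel_left] at this
  refine traceRadical_eq_bot hG ⟨hNG, fun Y hY => ?_⟩
  have := isNilpotent_lieCentralizer hG.1 hT
  obtain ⟨P, P', hP, hPT⟩ := IsTorus.exists_conj_diagonal hT.1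
  obtain ⟨Z, hZ, hZT, hZℓ⟩ := exists_commute_of_conj_diagonal hP hPT
    (lieOf (vanish (G : Set (GL (Fin n) K)))).toSubmodule
    (fun A hA X hX => conj_mem_lieOf G (hT.2.1 hA) hX) hY
  have h := hZℓ ((traceLinearMap (Fin n) K K).comp (LinearMap.mulLeft K N)) fun A hA Z _ => by
    change (N * (A * Z * ((A⁻¹ : GL (Fin n) K) : Matrix (Fin n) (Fin n) K))).trace = (N * Z).trace
    rw [← Matrix.mul_assoc, trace_mul_comm, ← Matrix.mul_assoc N, ← (hNT A hA).eq,
      ← Matrix.mul_assoc, ← Matrix.mul_assoc, Units.inv_mul, one_mul]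
  refine (h.symm.trans ?_)
  let c := lieCentralizer (lieOf (vanish (G : Set (GL (Fin n) K)))) T
  have ht := LieModule.traceForm_eq_sum_finrank_nsmul_mul K c (Fin n → K) ⟨N, hNG, hNT⟩ ⟨Z, hZ, hZT⟩
  rw [Finset.sum_eq_zero fun χ _ => ?_] at ht
  · rw [LieModule.traceForm_apply_apply] at ht
    change LinearMap.trace K _ (toLin' N ∘ₗ toLin' Z) = 0 at ht
    rw [← toLin'_mul, Matrix.trace_toLin'_eq] at ht
    exact ht
  · rw [χ.apply_eq_zero_of_isNilpotent ⟨N, hNG, hNT⟩ ⟨n, ?_⟩, zero_mul, smul_zero]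
    change (toLin' N) ^ n = 0
    rw [← toLin'_pow, hN, map_zero]

end GLZariski

namespace GLZariski

attribute [local instance] LieRing.ofAssociativeRing

variable {n : ℕ}

/-- Precomposition of polynomials with two-sided multiplication by matrices. -/
noncomputable def biTrans (A B : Matrix (Fin n) (Fin n) K) :
    MvPolynomial (Fin n × Fin n) K →ₐ[K] MvPolynomial (Fin n × Fin n) K :=
  ev (A.map C * Matrix.of (fun i j => X (i, j)) * B.map C)

lemma ev_biTrans (A B M : Matrix (Fin n) (Fin n) K) (p : MvPolynomial (Fin n × Fin n) K) :
    ev M (biTrans A B p) = ev (A * M * B) p := by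
  rw [biTrans, map_ev]
  congr 2
  ext i j
  simp [Matrix.mul_apply]

lemma ev_one_rder_biTrans {A B Y Z : Matrix (Fin n) (Fin n) K} (h : A * Z * B = A * B * Y)
    (p : MvPolynomial (Fin n × Fin n) K) :
    ev 1 (rder Z (biTrans A B p)) = ev (A * B) (rder Y p) := by
  have h1 : (A.map C * Matrix.of (fun i j => X (i, j)) * B.map C).map (ev (K := K) 1) = A * B := by
    ext i j
    simp [Matrix.mul_apply, Matrix.one_apply]
  have h2 := map_derivation_ev (rder Z) (ev (K := K) 1)
    (A.map C * Matrix.of (fun i j => X (i, j)) * B.map C) Y (by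
      rw [h1]
      change _ = A * B * Y
      rw [← h]
      ext i j
      simp [Matrix.mul_apply, Matrix.one_apply, mul_comm]) p
  rwa [h1] at h2

lemma lieOf_vanish_mono {G H : Subgroup (GL (Fin n) K)} (hHG : H ≤ G) :
    lieOf (vanish (H : Set (GL (Fin n) K))) ≤ lieOf (vanish (G : Set (GL (Fin n) K))) := by
  intro Y hY p hp A hA
  have h := hY (biTrans (A : Matrix (Fin n) (Fin n) K) 1 p) (fun B hB => by
    rw [ev_biTrans, mul_one, ← Units.val_mul]
    exact hp _ (G.mul_mem hA (hHG hB))) 1 H.one_mem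
  rw [Units.val_one, ev_one_rder_biTrans (Y := Y) (by simp), mul_one] at h
  exact h

/-- The differential at the identity of a polynomial. -/
noncomputable def diffOne (q : MvPolynomial (Fin n × Fin n) K) :
    Matrix (Fin n) (Fin n) K →ₗ[K] K where
  toFun Y := ev 1 (rder Y q)
  map_add' Y Z := by rw [rder_add, Derivation.add_apply, map_add]
  map_smul' c Y := by rw [rder_smul, Derivation.smul_apply, map_smul, RingHom.id_apply]

/-- A subgroup of a reductive group containing a maximal torus has no nonzero additive
characters. -/
theorem eq_zero_of_additive [IsAlgClosed K] [CharZero K] {G H T : Subgroup (GL (Fin n) K)}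
    (hG : IsReductive G) (hHG : H ≤ G) (hH : IsZClosed (H : Set (GL (Fin n) K)))
    (hT : IsMaximalTorus G T) (hTH : T ≤ H) {f : H →* Multiplicative K}
    {p : MvPolynomial ((Fin n × Fin n) ⊕ (Fin n × Fin n)) K}
    (hp : ∀ A : H, (f A).toAdd = eval (matOf (A : GL (Fin n) K)) p) (A : H) : (f A).toAdd = 0 := by
  obtain ⟨N, q, hq⟩ := exists_clear_denominators p
  replace hq (B : H) : ev (((B : GL (Fin n) K) : Matrix (Fin n) (Fin n) K)) q =
      ((B : GL (Fin n) K) : Matrix (Fin n) (Fin n) K).det ^ N * (f B).toAdd := by rw [hq, hp]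
  have hpow (B : H) (k : ℕ) : ev ((((B : GL (Fin n) K) : Matrix (Fin n) (Fin n) K)) ^ k) q =
      ((Matrix.GeneralLinearGroup.det (B : GL (Fin n) K) ^ N : Kˣ) : K) ^ k *
        (k * (f B).toAdd) := by
    have h := hq (B ^ k)
    rw [map_pow, toAdd_pow, nsmul_eq_mul, Subgroup.coe_pow, Units.val_pow_eq_pow_val,
      Matrix.det_pow] at h
    rw [h, ← pow_mul, mul_comm k N, pow_mul]
    rfl
  let H₀ : Subgroup (GL (Fin n) K) := f.ker.map H.subtype
  have hH₀ : IsZClosed (H₀ : Set (GL (Fin n) K)) := by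
    have : (H₀ : Set (GL (Fin n) K)) = (H : Set (GL (Fin n) K)) ∩
        {B : GL (Fin n) K | ∀ p ∈ ({q} : Set _),
        ev (B : Matrix (Fin n) (Fin n) K) p = 0} := by
      ext B
      simp only [Set.mem_inter_iff, Set.mem_ofPred_eq, Set.mem_singleton_iff, forall_eq,
        SetLike.mem_coe]
      constructor
      · rintro ⟨B, hB, rfl⟩
        refine ⟨B.2, (hq B).trans ?_⟩
        rw [MonoidHom.mem_ker.1 hB, toAdd_one, mul_zero]
      · rintro ⟨hB, hB0⟩
        refine ⟨⟨B, hB⟩, MonoidHom.mem_ker.2 ?_, rfl⟩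
        have := (hq ⟨B, hB⟩).symm.trans hB0
        exact (mul_eq_zero.1 this).resolve_left (pow_ne_zero _ (det_ne_zero B))
    rw [this]
    exact IsZClosed.inter hH (isZClosed_zeroLocus _)
  have hdiff₀ {Y : Matrix (Fin n) (Fin n) K}
      (hY : Y ∈ lieOf (vanish (H₀ : Set (GL (Fin n) K)))) : diffOne q Y = 0 := by
    refine hY q (fun B hB => ?_) 1 H₀.one_mem
    obtain ⟨B, hB, rfl⟩ := hB
    refine (hq B).trans ?_
    rw [MonoidHom.mem_ker.1 hB, toAdd_one, mul_zero]
  obtain ⟨Y, hY, hYA⟩ := exists_mem_lieOf_ev_rder_eq A.2 (hpow A)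
  obtain ⟨P, P', hP, hPT⟩ := IsTorus.exists_conj_diagonal hT.1
  obtain ⟨Z, hZ, hZT, hZℓ⟩ := exists_commute_of_conj_diagonal hP hPT
    (lieOf (vanish (H : Set (GL (Fin n) K)))).toSubmodule
    (fun B hB X hX => conj_mem_lieOf H (hTH hB) hX) hY
  have hZA := hZℓ (diffOne q) fun B hB Z hZ => by
    have h := hZ (biTrans (B : Matrix (Fin n) (Fin n) K)
      ((B⁻¹ : GL (Fin n) K) : Matrix (Fin n) (Fin n) K) q - q) (fun M hM => by
        have h1 := hq (⟨B, hTH hB⟩ * ⟨M, hM⟩ * ⟨B, hTH hB⟩⁻¹)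
        have h2 := hq ⟨M, hM⟩
        simp only [map_mul, map_inv, toAdd_mul, toAdd_inv] at h1
        rw [map_sub, ev_biTrans, sub_eq_zero, ← Units.val_mul, ← Units.val_mul]
        refine h1.trans (.trans ?_ h2.symm)
        congr 2
        · simp only [Subgroup.coe_mul, Subgroup.coe_inv, Units.val_mul, Matrix.det_mul]
          rw [mul_right_comm, ← Matrix.det_mul, Units.mul_inv, Matrix.det_one, one_mul]
        · ring) 1 H.one_mem
    rw [Units.val_one, map_sub, map_sub, sub_eq_zero, ev_one_rder_biTrans
      (Y := (B : Matrix (Fin n) (Fin n) K) * Z * ((B⁻¹ : GL (Fin n) K) : Matrix (Fin n) (Fin n) K))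
      (by rw [Units.mul_inv, one_mul]), Units.mul_inv] at h
    exact h
  obtain ⟨Q, Q', d, M, hQ, hZM, hM, hS, hMc⟩ := exists_jordan_decomposition Z
  have hSM : Commute (Q * diagonal d * Q') M := (hS M (hMc _ (Commute.refl _)).symm).symm
  have hM0 : M = 0 := nilpotent_part_eq_zero hG hT hQ hM hSM (hZM ▸ lieOf_vanish_mono hHG hZ)
    fun B hB => hMc _ (hZT B hB)
  have hZ' : Q * diagonal d * Q' + M ∈ lieOf (vanish (H : Set (GL (Fin n) K))) := hZM ▸ hZ
  have hS₀ : Q * diagonal d * Q' ∈ (lieOf (vanish (H₀ : Set (GL (Fin n) K)))).toSubmodule := by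
    refine conj_diagonal_mem_of_forall_dual _
      (l := fun i => ⟨d i, Submodule.subset_span ⟨i, rfl⟩⟩) (fun _ => rfl) fun ψ => ?_
    refine mem_lieOf_of_zpow hQ _ fun z => ?_
    obtain ⟨B, hB, hBz⟩ := exists_mem_eq_zpow hH hQ hM hSM hZ' ψ
      (l := fun i => ⟨d i, Submodule.subset_span ⟨i, rfl⟩⟩) (fun _ => rfl) z
    exact ⟨B, ⟨⟨B, hB⟩, MonoidHom.mem_ker.2
      (eq_zero_of_conj_diagonal hQ hBz (hpow ⟨B, hB⟩)), rfl⟩, hBz⟩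
  rw [← hYA]
  refine hZA.symm.trans ?_
  rw [hZM, hM0, add_zero]
  exact hdiff₀ hS₀

end GLZariski

/-- reformulation of Lemma 2.3.6. Over an algebraically closed field of
characteristic 0, if `H ≤ G` is a closed subgroup of a reductive group containing a maximal
torus of `G`, then `Ext¹_H(K, K) = 0`: every algebraic extension of the trivial 1-dimensional
representation of `H` by itself splits. Such an extension is a 2-dimensional algebraic
representation `ρ` by upper unitriangular matrices; it splits iff the off-diagonal entry
vanishes identically. -/
theorem ext_trivial_rep_vanishes
    {K : Type} [Field K] [IsAlgClosed K] [CharZero K] {n : ℕ}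
    (G H : Subgroup (GL (Fin n) K)) (hG : IsReductive G) (hHG : H ≤ G)
    (hHcl : IsZClosed (H : Set (GL (Fin n) K)))
    (hT : ∃ T : Subgroup (GL (Fin n) K), IsMaximalTorus G T ∧ T ≤ H)
    (ρ : AlgGroupHom H (⊤ : Subgroup (GL (Fin 2) K)))
    (hext : ∀ h : H,
      ((ρ.toFun h : GL (Fin 2) K) : Matrix (Fin 2) (Fin 2) K) 0 0 = 1 ∧
      ((ρ.toFun h : GL (Fin 2) K) : Matrix (Fin 2) (Fin 2) K) 1 1 = 1 ∧
      ((ρ.toFun h : GL (Fin 2) K) : Matrix (Fin 2) (Fin 2) K) 1 0 = 0) :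
    ∀ h : H, ((ρ.toFun h : GL (Fin 2) K) : Matrix (Fin 2) (Fin 2) K) 0 1 = 0 := by
  obtain ⟨T, hT, hTH⟩ := hT
  obtain ⟨p, hp⟩ := ρ.poly 0 1
  exact GLZariski.eq_zero_of_additive hG hHG hHcl hT hTH (p := p)
    (f := MonoidHom.mk' (fun h => Multiplicative.ofAdd
      (((ρ.toFun h : GL (Fin 2) K) : Matrix (Fin 2) (Fin 2) K) 0 1)) fun A B => by
        rw [← ofAdd_add, map_mul, Subgroup.coe_mul, Units.val_mul, Matrix.mul_apply,
          Fin.sum_univ_two, (hext A).1, (hext B).2.1, one_mul, mul_one, add_comm]) hp
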